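/- arXiv:2202.06291 — 2 statements merged into one kernel-verified Lean document; each statement's English description precedes it below -/
import Mathlib

section
/- Let A be a commutative Noetherian ring of dimension d containing an infinite field k, and let P be a finitely generated projective A[T₁,…,T_r]-module of rank n which is extended from A, with 2n ≥ d + 3. If P_f has a unimodular element for some polynomial f ∈ A[T₁,…,T_r] that is monic in T_r, then P has a unimodular element. -/
open TensorProduct

/-- The height of an ideal: the infimum of the dimensions of localizations at primes
containing it. -/
noncomputable def idealHt {A : Type*} [CommRing A] (I : Ideal A) : WithBot (WithTop ℕ) :=
  ⨅ p ∈ {p : PrimeSpectrum A | I ≤ p.asIdeal}, ringKrullDim (Localization.AtPrime p.asIdeal)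

/-- A module has a unimodular element if some element is mapped to `1` by a linear functional. -/
def HasUnimodular (R M : Type*) [CommRing R] [AddCommGroup M] [Module R M] : Prop :=
  ∃ (m : M) (φ : M →ₗ[R] R), φ m = 1

/-- The local rank of a module at every prime, as a constant-rank condition. -/
def HasRank (R M : Type*) [CommRing R] [AddCommGroup M] [Module R M] (n : ℕ) : Prop :=
  ∀ p : PrimeSpectrum R,
    Module.rank (Localization.AtPrime p.asIdeal) (LocalizedModule p.asIdeal.primeCompl M) = n

/-- `Spec A` is regular at the prime `p` if the maximal ideal of the (Noetherian) local ring
`A_p` is generated by `dim A_p` elements. -/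
def RegularAt (A : Type*) [CommRing A] (p : PrimeSpectrum A) : Prop :=
  ∃ s : Finset (Localization.AtPrime p.asIdeal),
    Ideal.span (s : Set (Localization.AtPrime p.asIdeal)) = IsLocalRing.maximalIdeal _ ∧
    (s.card : WithBot (WithTop ℕ)) = ringKrullDim (Localization.AtPrime p.asIdeal)

section UnimodularDescent

open Polynomial

section Avoidance
variable {k B : Type*} [Field k] [Infinite k] [CommRing B] [Algebra k B]

theorem exists_add_smul_notMem_of_finite {S : Set (Ideal B)} (hS : S.Finite) {t : B}
    (htS : ∀ Q ∈ S, t ∉ Q) (y : B) : ∃ c : k, ∀ Q ∈ S, y + c • t ∉ Q := by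
  have hfin : (⋃ Q ∈ S, {c : k | y + c • t ∈ Q}).Finite := by
    refine hS.biUnion fun Q hQ => Set.Subsingleton.finite fun c hc c' hc' => ?_
    by_contra hne
    refine htS Q hQ ?_
    have h : (c - c') • t ∈ Q := by
      have := Q.sub_mem hc hc'
      rwa [add_sub_add_left_eq_sub, ← sub_smul] at this
    have h2 := Submodule.smul_of_tower_mem Q (c - c')⁻¹ h
    rwa [inv_smul_smul₀ (sub_ne_zero.2 hne)] at h2
  obtain ⟨c, hc⟩ := hfin.infinite_compl.nonempty
  refine ⟨c, fun Q hQ h => hc ?_⟩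
  exact Set.mem_biUnion hQ h

theorem exists_smul_le_height [IsNoetherianRing B] (t : B) (y : ℕ → B) (r : ℕ) :
    ∃ c : ℕ → k, ∀ P : Ideal B, P.IsPrime → t ∉ P → (∀ j < r, y j + c j • t ∈ P) →
      (r : ℕ∞) ≤ P.height := by
  induction r with
  | zero => exact ⟨0, fun _ _ _ _ => by simp⟩
  | succ r ih =>
    obtain ⟨c, hc⟩ := ih
    let I : Ideal B := Ideal.span ((fun j => y j + c j • t) '' Set.Iio r)
    obtain ⟨a, ha⟩ := exists_add_smul_notMem_of_finite (k := k)
      (S := {Q ∈ I.minimalPrimes | t ∉ Q})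
      ((I.finite_minimalPrimes_of_isNoetherianRing B).subset fun Q h => h.1)
      (fun Q h => h.2) (y r)
    refine ⟨Function.update c r a, fun P hP htP hPy => ?_⟩
    have hI : I ≤ P := by
      refine Ideal.span_le.2 ?_
      rintro _ ⟨j, hj, rfl⟩
      have := hPy j (Nat.lt_succ_of_lt hj)
      rwa [Function.update_of_ne (Set.mem_Iio.1 hj).ne] at this
    obtain ⟨Q, hQ, hQP⟩ := Ideal.exists_minimalPrimes_le hI
    have htQ : t ∉ Q := fun h => htP (hQP h)
    have := hQ.1.1
    have hrQ : (r : ℕ∞) ≤ Q.height := hc Q this htQ fun j hj =>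
      hQ.1.2 (Ideal.subset_span ⟨j, hj, rfl⟩)
    have hlt : Q < P := by
      refine lt_of_le_of_ne hQP fun h => ha Q ⟨hQ, htQ⟩ ?_
      have := hPy r (Nat.lt_succ_self r)
      rwa [Function.update_self, ← h] at this
    push_cast
    exact (add_le_add_left hrQ 1).trans (Ideal.height_add_one_le_of_lt_of_isPrime hlt)

end Avoidance

section GeneralPosition
variable {A B : Type*} [CommRing A] [CommRing B]
  [Algebra A B] {L : ℕ}

/-- `H` contains `n` vectors which, up to the scalar `b`, admit a dual family of functionals. -/
def HasDualFamily (H : Submodule A (Fin L → A)) (n : ℕ) (b : A) : Prop :=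
  ∃ (x φ : Fin n → Fin L → A), (∀ i, x i ∈ H) ∧
    ∀ i j, φ j ⬝ᵥ x i = if i = j then b else 0

theorem HasDualFamily.exists_le_height (k : Type*) [Field k] [Infinite k] [Algebra k A]
    [IsNoetherianRing B] {H : Submodule A (Fin L → A)} {n : ℕ}
    {b : A} (hb : HasDualFamily H n b) (t : B) (y : Fin L → B) :
    ∃ h ∈ H, ∀ P : Ideal B, P.IsPrime → t ∉ P → algebraMap A B b ∉ P →
      (∀ i, y i + t * algebraMap A B (b * h i) ∈ P) → (n : ℕ∞) ≤ P.height := by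
  obtain ⟨x, φ, hx, hφ⟩ := hb
  let : Algebra k B := ((algebraMap A B).comp (algebraMap k A)).toAlgebra
  have hk (c : k) (z : B) : c • z = algebraMap A B (algebraMap k A c) * z := Algebra.smul_def c z
  obtain ⟨c, hc⟩ := exists_smul_le_height (k := k) (t * algebraMap A B (b * b))
    (fun j => if hj : j < n then ∑ i, algebraMap A B (φ ⟨j, hj⟩ i) * y i else 0) n
  refine ⟨∑ j : Fin n, algebraMap k A (c j) • x j, H.sum_mem fun j _ => H.smul_mem _ (hx j),
    fun P hP htP hbP hy => hc P hP ?_ fun j hj => ?_⟩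
  · rw [map_mul]
    exact fun h => (hP.mem_or_mem h).elim htP fun h => (hP.mem_or_mem h).elim hbP hbP
  · have h1 := P.sum_mem (t := Finset.univ) fun i _ =>
      P.mul_mem_left (algebraMap A B (φ ⟨j, hj⟩ i)) (hy i)
    convert h1 using 1
    have h2 : φ ⟨j, hj⟩ ⬝ᵥ (∑ j : Fin n, algebraMap k A (c j) • x j) = algebraMap k A (c j) * b := by
      rw [dotProduct_sum, Finset.sum_eq_single ⟨j, hj⟩] <;>
        simp +contextual [dotProduct_smul, hφ, -algebraMap_smul]
    simp only [mul_add, Finset.sum_add_distrib, hj, dif_pos, hk]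
    congr 1
    calc _ = t * algebraMap A B (b * (algebraMap k A (c j) * b)) := by simp only [map_mul]; ring
      _ = _ := by
        rw [← h2, dotProduct, Finset.mul_sum, map_sum, Finset.mul_sum]
        refine Finset.sum_congr rfl fun i _ => ?_
        simp only [map_mul]; ring

theorem exists_le_height_of_span_eq_top (k : Type*) [Field k] [Infinite k] [Algebra k A]
    [IsNoetherianRing B] {H : Submodule A (Fin L → A)} {n : ℕ}
    (hH : Ideal.span {b | HasDualFamily H n b} = ⊤) (t : B) (y : Fin L → B) :
    ∃ h ∈ H, ∀ P : Ideal B, P.IsPrime → t ∉ P →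
      (∀ i, y i + t * algebraMap A B (h i) ∈ P) → (n : ℕ∞) ≤ P.height := by
  obtain ⟨s, hs, hs1⟩ := Submodule.mem_span_finite_of_mem_span ((Ideal.eq_top_iff_one _).1 hH)
  have key : ∀ s : Finset A, (s : Set A) ⊆ {b | HasDualFamily H n b} →
      ∃ h ∈ H, ∀ P : Ideal B, P.IsPrime → t ∉ P → (∃ b ∈ s, algebraMap A B b ∉ P) →
      (∀ i, y i + t * algebraMap A B (h i) ∈ P) → (n : ℕ∞) ≤ P.height := by
    classical
    intro s
    induction s using Finset.induction_on with
    | empty => exact fun _ => ⟨0, H.zero_mem, by simp⟩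
    | insert b s _ ih =>
      intro hs
      rw [Finset.coe_insert, Set.insert_subset_iff] at hs
      obtain ⟨h, hh, hP⟩ := ih hs.2
      obtain ⟨h', hh', hP'⟩ := hs.1.exists_le_height k t
        fun i => y i + t * algebraMap A B (h i)
      refine ⟨h + b • h', H.add_mem hh (H.smul_mem _ hh'), fun P pP htP hbP hy => ?_⟩
      by_cases hb : algebraMap A B b ∈ P
      · refine hP P pP htP ?_ fun i => ?_
        · obtain ⟨b', hb', hbP⟩ := hbP
          rcases Finset.mem_insert.1 hb' with rfl | h
          exacts [absurd hb hbP, ⟨b', h, hbP⟩]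
        · have := P.sub_mem (hy i) (P.mul_mem_left (t * algebraMap A B (h' i)) hb)
          convert this using 1
          simp only [Pi.add_apply, Pi.smul_apply, smul_eq_mul, map_add, map_mul]; ring
      · refine hP' P pP htP hb fun i => ?_
        convert hy i using 1
        simp only [Pi.add_apply, Pi.smul_apply, smul_eq_mul, map_add, map_mul]; ring
  obtain ⟨h, hh, hP⟩ := key s hs
  refine ⟨h, hh, fun P pP htP hy => hP P pP htP ?_ hy⟩
  by_contra! hcon
  refine pP.ne_top ((Ideal.eq_top_iff_one _).2 ?_)
  have : Submodule.span A (s : Set A) ≤ P.comap (algebraMap A B) := Submodule.span_le.2 hcon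
  simpa using this hs1

theorem exists_forall_isPrime_false (k : Type*) [Field k] [Infinite k] [Algebra k A]
    [IsNoetherianRing B] {H : Submodule A (Fin L → A)} {n : ℕ}
    (hH : Ideal.span {b | HasDualFamily H n b} = ⊤) (K : Ideal B) (hK : ringKrullDim (B ⧸ K) < n)
    (t : B) (y : Fin L → B) :
    ∃ h ∈ H, ∀ P : Ideal B, P.IsPrime → K ≤ P → t ∉ P →
      ¬ ∀ i, y i + t * algebraMap A B (h i) ∈ P := by
  obtain ⟨h, hh, hP⟩ := exists_le_height_of_span_eq_top k hH (Ideal.Quotient.mk K t)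
    fun i => Ideal.Quotient.mk K (y i)
  refine ⟨h, hh, fun P pP hKP htP hy => ?_⟩
  have hmem (z : B) : Ideal.Quotient.mk K z ∈ P.map (Ideal.Quotient.mk K) ↔ z ∈ P := by
    rw [Ideal.mem_quotient_iff_mem hKP]
  have pP' : (P.map (Ideal.Quotient.mk K)).IsPrime :=
    Ideal.map_isPrime_of_surjective Ideal.Quotient.mk_surjective (by simpa using hKP)
  have h1 := hP _ pP' (by rwa [hmem]) fun i => by
    have : algebraMap A (B ⧸ K) (h i) = Ideal.Quotient.mk K (algebraMap A B (h i)) := rfl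
    rw [this, ← map_mul, ← map_add, hmem]
    exact hy i
  have h2 := Ideal.height_le_ringKrullDim_of_isPrime (I := P.map (Ideal.Quotient.mk K))
  have h3 : ((n : ℕ∞) : WithBot ℕ∞) ≤ ((P.map (Ideal.Quotient.mk K)).height : WithBot ℕ∞) :=
    WithBot.coe_le_coe.2 h1
  exact absurd (h3.trans h2) (not_le.2 hK)

end GeneralPosition

section Elimination
variable {A : Type*} [CommRing A]

theorem Polynomial.Monic.isIntegral_quotient {I : Ideal A[X]} {f : A[X]} (hf : f.Monic)
    (hfI : f ∈ I) : Algebra.IsIntegral A (A[X] ⧸ I) := by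
  have := hf.finite_quotient
  have hle : Ideal.span {f} ≤ I := (Ideal.span_singleton_le_iff_mem I).2 hfI
  have : Module.Finite A (A[X] ⧸ I) :=
    Module.Finite.of_surjective (Ideal.Quotient.factorₐ A hle).toLinearMap
      (Ideal.Quotient.factor_surjective hle)
  infer_instance

theorem exists_isPrime_height_add_length_le {I : Ideal A[X]} {f : A[X]} (hf : f.Monic)
    (hfI : f ∈ I) {n : ℕ} (hI : ∀ P : Ideal A[X], P.IsPrime → I ≤ P → (n : ℕ∞) ≤ P.height)
    (s : LTSeries (PrimeSpectrum A)) (hs : I.comap C ≤ s.head.asIdeal) :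
    ∃ Q : Ideal (A[X] ⧸ I), Q.IsPrime ∧ Q.comap (algebraMap A (A[X] ⧸ I)) = s.last.asIdeal ∧
      ((n + s.length : ℕ) : ℕ∞) ≤ (Q.comap (Ideal.Quotient.mk I)).height := by
  have := hf.isIntegral_quotient hfI
  induction s using RelSeries.inductionOn' with
  | singleton x =>
    obtain ⟨Q, -, hQ, hQx⟩ := Ideal.exists_ideal_over_prime_of_isIntegral x.asIdeal
      (⊥ : Ideal (A[X] ⧸ I)) (by
        intro a ha
        refine hs ?_
        exact Ideal.mem_comap.2 <|
          Ideal.Quotient.eq_zero_iff_mem.1 (ha : Ideal.Quotient.mk I (C a) = 0))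
    refine ⟨Q, hQ, hQx, ?_⟩
    refine hI _ (Ideal.comap_isPrime _ _) fun z hz => ?_
    rw [Ideal.mem_comap, Ideal.Quotient.eq_zero_iff_mem.2 hz]
    exact Q.zero_mem
  | snoc s x hx ih =>
    rw [RelSeries.head_snoc] at hs
    obtain ⟨Q, hQ, hQs, hn⟩ := ih hs
    obtain ⟨Q', hQQ', hQ', hQx⟩ := Ideal.exists_ideal_over_prime_of_isIntegral_of_isPrime x.asIdeal
      Q (hQs.trans_le hx.le)
    refine ⟨Q', hQ', by simpa using hQx, ?_⟩
    have hne : Q.comap (Ideal.Quotient.mk I) < Q'.comap (Ideal.Quotient.mk I) := by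
      refine lt_of_le_of_ne (Ideal.comap_mono hQQ') fun h => ?_
      have h2 := Ideal.comap_injective_of_surjective _ Ideal.Quotient.mk_surjective h
      have hx' : s.last < x := hx
      rw [h2, hQx] at hQs
      exact hx'.ne' (PrimeSpectrum.ext hQs)
    have := Ideal.height_add_one_le_of_lt_of_isPrime hne
    refine le_trans ?_ this
    rw [RelSeries.snoc_length, ← add_assoc]
    push_cast at hn ⊢
    gcongr

theorem ringKrullDim_quotient_comap_C_add_le [IsNoetherianRing A] {I : Ideal A[X]} {f : A[X]}
    (hf : f.Monic) (hfI : f ∈ I) {n d : ℕ} (hd : ringKrullDim A = d)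
    (hI : ∀ P : Ideal A[X], P.IsPrime → I ≤ P → (n : ℕ∞) ≤ P.height) (m : ℕ) (hm : d + 1 < n + m) :
    ringKrullDim (A ⧸ I.comap C) < m := by
  rw [ringKrullDim, Order.krullDim_lt_coe_iff]
  intro s
  have hmono : StrictMono (PrimeSpectrum.comap (Ideal.Quotient.mk (I.comap (C : A →+* A[X])))) :=
    Monotone.strictMono_of_injective (fun _ _ h => Ideal.comap_mono h)
      (PrimeSpectrum.comap_injective_of_surjective _ Ideal.Quotient.mk_surjective)
  obtain ⟨Q, hQ, -, hn⟩ := exists_isPrime_height_add_length_le hf hfI hI (s.map _ hmono) (by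
    intro a ha
    have h0 : Ideal.Quotient.mk (I.comap (C : A →+* A[X])) a = 0 :=
      Ideal.Quotient.eq_zero_iff_mem.2 ha
    have : Ideal.Quotient.mk (I.comap (C : A →+* A[X])) a ∈ s.head.asIdeal :=
      h0 ▸ s.head.asIdeal.zero_mem
    exact this)
  have h1 : ((n + s.length : ℕ) : WithBot ℕ∞) ≤ ((d + 1 : ℕ) : WithBot ℕ∞) := by
    have h2 := Ideal.height_le_ringKrullDim_of_isPrime (I := Q.comap (Ideal.Quotient.mk I))
    rw [Polynomial.ringKrullDim_of_isNoetherianRing, hd] at h2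
    refine le_trans ?_ (h2.trans (by simp))
    exact WithBot.coe_le_coe.2 hn
  have := Nat.cast_le.1 h1
  omega

theorem pow_smul_mk_mem_smul_map_degreeLT {c : Ideal A[X]} {J : Ideal A} {F : A[X]} {m : ℕ}
    (hF : F ∈ c) (hFm : F.natDegree ≤ m) (e : ℕ) (p : A[X]) (hp : p ∈ J.map C)
    (hpe : p.degree < (m + e : ℕ)) :
    F.coeff m ^ e • Ideal.Quotient.mk c p ∈
      J • (degreeLT A m).map (Ideal.Quotient.mkₐ A c).toLinearMap := by
  induction e generalizing p with
  | zero =>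
    rw [pow_zero, one_smul, p.as_sum_range_C_mul_X_pow, map_sum]
    refine Submodule.sum_mem _ fun i hi => ?_
    rw [← smul_eq_C_mul, ← Ideal.Quotient.mkₐ_eq_mk A, map_smul]
    by_cases h0 : p = 0
    · simp [h0]
    · refine Submodule.smul_mem_smul (Ideal.mem_map_C_iff.1 hp i)
        (Submodule.mem_map_of_mem (mem_degreeLT.2 ?_))
      refine (degree_X_pow_le i).trans_lt ?_
      have := (natDegree_lt_iff_degree_lt h0).2 hpe
      have h2 := Finset.mem_range.1 hi
      exact_mod_cast (by omega : i < m)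
  | succ e ih =>
    have hFX : C (p.coeff (m + e)) * X ^ e * F ∈ c := c.mul_mem_left _ hF
    have h1 := ih (C (F.coeff m) * p - C (p.coeff (m + e)) * X ^ e * F) ?_ ?_
    · rw [map_sub, Ideal.Quotient.eq_zero_iff_mem.2 hFX, sub_zero, ← smul_eq_C_mul,
        ← Ideal.Quotient.mkₐ_eq_mk A, map_smul, smul_smul, ← pow_succ] at h1
      exact h1
    · refine Ideal.sub_mem _ (Ideal.mul_mem_left _ _ hp) (Ideal.mul_mem_right _ _
        (Ideal.mul_mem_right _ _ (Ideal.mem_map_of_mem _ (Ideal.mem_map_C_iff.1 hp _))))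
    · rw [degree_lt_iff_coeff_zero]
      intro i hi
      have hFi : (C (p.coeff (m + e)) * X ^ e * F).coeff i = p.coeff (m + e) * F.coeff (i - e) := by
        rw [mul_assoc, coeff_C_mul, coeff_X_pow_mul', if_pos (by omega)]
      rw [coeff_sub, coeff_C_mul, hFi]
      rcases hi.eq_or_lt with rfl | hlt
      · rw [Nat.add_sub_cancel]; ring
      · have hFe : F.natDegree < i - e := by omega
        have hie : m + (e + 1) ≤ i := by omega
        rw [coeff_eq_zero_of_natDegree_lt hFe,
          coeff_eq_zero_of_degree_lt (p := p) (hpe.trans_le (by exact_mod_cast hie))]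
        simp

/-- Elimination: if `c` contains a polynomial of degree at most `m` whose coefficient of degree `m`
is `1` modulo `J`, then comaximality with `J` descends to constants. -/
theorem exists_C_mem_of_sup_eq_top {c : Ideal A[X]} {J : Ideal A} {F : A[X]} {m : ℕ} (hm : 0 < m)
    (hF : F ∈ c) (hFm : F.natDegree ≤ m) (hFJ : F.coeff m - 1 ∈ J) (hc : c ⊔ J.map C = ⊤) :
    ∃ τ, C τ ∈ c ∧ τ - 1 ∈ J := by
  set N := (degreeLT A m).map (Ideal.Quotient.mkₐ A c).toLinearMap with hN
  have hNfg : N.FG := by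
    refine Submodule.FG.map _ ?_
    classical
    rw [degreeLT_eq_span_X_pow]
    exact Submodule.fg_span (Finset.finite_toSet _)
  have hNJ : N ≤ J • N := by
    rintro _ ⟨x, hx, rfl⟩
    obtain ⟨u, hu, w, hw, huw⟩ := Submodule.mem_sup.1 ((Ideal.eq_top_iff_one _).1 hc)
    have hxw : Ideal.Quotient.mk c x = Ideal.Quotient.mk c (w * x) := by
      rw [Ideal.Quotient.mk_eq_mk_iff_sub_mem]
      have : x - w * x = x * u := by linear_combination (-x) * huw
      exact this ▸ c.mul_mem_left _ hu
    have h1 := pow_smul_mk_mem_smul_map_degreeLT hF hFm ((w * x).natDegree + 1) _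
      (Ideal.mul_mem_right x _ hw) (degree_le_natDegree.trans_lt (by exact_mod_cast (by omega)))
    rw [← hxw] at h1
    have h2 : F.coeff m ^ ((w * x).natDegree + 1) - 1 ∈ J := by
      have := sub_dvd_pow_sub_pow (F.coeff m) 1 ((w * x).natDegree + 1)
      rw [one_pow] at this
      exact J.mem_of_dvd this hFJ
    have h3 := Submodule.sub_mem _ h1 (Submodule.smul_mem_smul h2
      (show Ideal.Quotient.mk c x ∈ N from ⟨x, hx, rfl⟩))
    rw [sub_smul, one_smul, sub_sub_cancel] at h3
    exact h3
  obtain ⟨r, hr, hrN⟩ := Submodule.exists_sub_one_mem_and_smul_eq_zero_of_fg_of_le_smul J N hNfg hNJ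
  refine ⟨r, ?_, hr⟩
  have := hrN (Ideal.Quotient.mk c 1) ⟨1, mem_degreeLT.2 (degree_one_le.trans_lt
    (by exact_mod_cast hm)), rfl⟩
  rw [← Ideal.Quotient.mkₐ_eq_mk A, ← map_smul, smul_eq_C_mul, mul_one, Ideal.Quotient.mkₐ_eq_mk,
    Ideal.Quotient.eq_zero_iff_mem] at this
  exact this
end Elimination

section Core
variable {A : Type*} [CommRing A] {L : ℕ}

/-- All coefficient vectors of the vector of polynomials `q` lie in `H`. -/
def HasCoeffsIn (H : Submodule A (Fin L → A)) (q : Fin L → A[X]) : Prop :=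
  ∀ j, (fun i => (q i).coeff j) ∈ H

theorem HasCoeffsIn.add {H : Submodule A (Fin L → A)} {q q' : Fin L → A[X]} (hq : HasCoeffsIn H q)
    (hq' : HasCoeffsIn H q') : HasCoeffsIn H (q + q') := fun j => by
  simpa [Pi.add_def] using H.add_mem (hq j) (hq' j)

theorem HasCoeffsIn.smul {H : Submodule A (Fin L → A)} {q : Fin L → A[X]} (p : A[X])
    (hq : HasCoeffsIn H q) : HasCoeffsIn H (p • q) := fun j => by
  have : (fun i => ((p • q) i).coeff j) =
      ∑ x ∈ Finset.HasAntidiagonal.antidiagonal j, p.coeff x.1 • fun i => (q i).coeff x.2 := by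
    ext i
    simp [coeff_mul]
  rw [this]
  exact H.sum_mem fun x _ => H.smul_mem _ (hq x.2)

theorem hasCoeffsIn_C {H : Submodule A (Fin L → A)} {h : Fin L → A} (hh : h ∈ H) :
    HasCoeffsIn H (fun i => C (h i)) := fun j => by
  by_cases hj : j = 0
  · simpa [coeff_C, hj] using hh
  · simp only [coeff_C, hj, if_false]
    exact H.zero_mem

theorem exists_monic_dotProduct_forall_le_height (k : Type*) [Field k] [Infinite k] [Algebra k A]
    [IsNoetherianRing A] [Nontrivial A] {H : Submodule A (Fin L → A)} {n : ℕ}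
    (hH : Ideal.span {b | HasDualFamily H n b} = ⊤) {q y : Fin L → A[X]} (hq : HasCoeffsIn H q)
    (hf : (y ⬝ᵥ q).Monic) :
    ∃ q', HasCoeffsIn H q' ∧ (y ⬝ᵥ q').Monic ∧
      ∀ P : Ideal A[X], P.IsPrime → (∀ i, q' i ∈ P) → (n : ℕ∞) ≤ P.height := by
  set K := (Finset.univ.sup fun i => (y i).natDegree) + 1 with hK
  obtain ⟨s, hs, hP⟩ := exists_le_height_of_span_eq_top k hH (1 : A[X]) fun i => X ^ K * q i
  refine ⟨(X ^ K : A[X]) • q + fun i => C (s i), (hq.smul _).add (hasCoeffsIn_C hs), ?_,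
    fun P pP hqP => hP P pP ((Ideal.ne_top_iff_one P).1 pP.ne_top) fun i => ?_⟩
  · rw [dotProduct_add, dotProduct_smul, smul_eq_mul]
    refine ((monic_X_pow K).mul hf).add_of_left ?_
    rw [degree_eq_natDegree ((monic_X_pow K).mul hf).ne_zero, (monic_X_pow K).natDegree_mul hf,
      natDegree_X_pow]
    refine (degree_sum_le _ _).trans_lt ((Finset.sup_lt_iff (WithBot.bot_lt_coe _)).2 fun i _ => ?_)
    have h1 : (y i).natDegree ≤ Finset.univ.sup fun i => (y i).natDegree :=
      Finset.le_sup (f := fun i => (y i).natDegree) (Finset.mem_univ i)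
    have h2 := natDegree_mul_C_le (y i) (s i)
    change (y i * C (s i)).degree < _
    refine degree_le_natDegree.trans_lt ?_
    exact_mod_cast (by omega : (y i * C (s i)).natDegree < K + (y ⬝ᵥ q).natDegree)
  · simpa using hqP i

/-- Evaluation at `a` of the polynomial reversed in degree `m`, along a homomorphism to a field. -/
theorem map_sum_pow_mul_coeff {F : Type*} [Field F] (φ : A →+* F) {g : A[X]} {m : ℕ}
    (hg : g.natDegree ≤ m) {a : A} (ha : φ a ≠ 0) :
    φ (∑ j ∈ Finset.range (m + 1), a ^ (m - j) * g.coeff j) =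
      φ a ^ m * g.eval₂ φ (φ a)⁻¹ := by
  rw [eval₂_eq_sum_range' φ (Nat.lt_succ_of_le hg), map_sum, Finset.mul_sum]
  refine Finset.sum_congr rfl fun j hj => ?_
  have hj : j ≤ m := Nat.le_of_lt_succ (Finset.mem_range.1 hj)
  rw [map_mul, map_pow, inv_pow, pow_sub₀ _ ha hj]
  ring

theorem map_sum_pow_mul_coeff_of_eq_zero {F : Type*} [CommRing F] (φ : A →+* F) (g : A[X]) (m : ℕ)
    {a : A} (ha : φ a = 0) :
    φ (∑ j ∈ Finset.range (m + 1), a ^ (m - j) * g.coeff j) = φ (g.coeff m) := by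
  rw [Finset.sum_range_succ, Nat.sub_self, pow_zero, one_mul, map_add, map_sum,
    Finset.sum_eq_zero, zero_add]
  intro j hj
  have := Finset.mem_range.1 hj
  rw [map_mul, map_pow, ha, zero_pow (by omega), zero_mul]

theorem ringKrullDim_quotient_map_C_lt [IsNoetherianRing A] {J : Ideal A} {n : ℕ}
    (h : ringKrullDim (A ⧸ J) < n) : ringKrullDim (A[X] ⧸ J.map C) < (n + 1 : ℕ) := by
  rw [← ringKrullDim_eq_of_ringEquiv (Ideal.polynomialQuotientEquivQuotientPolynomial J),
    Polynomial.ringKrullDim_of_isNoetherianRing]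
  cases hx : ringKrullDim (A ⧸ J) with
  | bot => exact WithBot.bot_lt_coe _
  | coe x =>
    rw [hx] at h
    have hxn : x < n := by exact_mod_cast h
    have : x + 1 < (n + 1 : ℕ) := by
      push_cast
      exact (ENat.add_lt_add_iff_right (by simp)).2 hxn
    exact_mod_cast this

theorem exists_mem_span_range_eq_top_of_forall_le_height (k : Type*) [Field k] [Infinite k]
    [Algebra k A] [IsNoetherianRing A] [Nontrivial A] {d n : ℕ} (hd : ringKrullDim A = d)
    (hn : d + 3 ≤ 2 * n) {H : Submodule A (Fin L → A)}
    (hH : Ideal.span {b | HasDualFamily H n b} = ⊤) {q y : Fin L → A[X]} (hq : HasCoeffsIn H q)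
    (hf : (y ⬝ᵥ q).Monic)
    (hqn : ∀ P : Ideal A[X], P.IsPrime → (∀ i, q i ∈ P) → (n : ℕ∞) ≤ P.height) :
    ∃ p ∈ H, Ideal.span (Set.range p) = ⊤ := by
  set f := y ⬝ᵥ q with hf_def
  set I : Ideal A[X] := Ideal.span (Set.range q) with hI_def
  have hqI (i) : q i ∈ I := Ideal.subset_span ⟨i, rfl⟩
  have hI_le {P : Ideal A[X]} : I ≤ P ↔ ∀ i, q i ∈ P := by
    rw [hI_def, Ideal.span_le, Set.range_subset_iff]; rfl
  have hfI : f ∈ I := I.sum_mem fun i _ => I.mul_mem_left _ (hqI i)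
  set J : Ideal A := I.comap C with hJ_def
  have hJI : J.map C ≤ I := Ideal.map_comap_le
  have hdim := ringKrullDim_quotient_comap_C_add_le hf hfI hd
    fun P pP h => hqn P pP (hI_le.1 h)
  obtain ⟨v, hv, hvJ⟩ := exists_forall_isPrime_false k hH J (hdim n (by omega)) 1 (0 : Fin L → A)
  obtain ⟨ψ, hψ⟩ : ∃ ψ : Fin L → A, ψ ⬝ᵥ v - 1 ∈ J := by
    have htop : J ⊔ Ideal.span (Set.range v) = ⊤ := by
      by_contra hne
      obtain ⟨P, hP, hle⟩ := Ideal.exists_le_maximal _ hne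
      refine hvJ P hP.isPrime (le_sup_left.trans hle)
        ((Ideal.ne_top_iff_one P).1 hP.ne_top) fun i => ?_
      simpa using hle (le_sup_right (a := J) (Ideal.subset_span ⟨i, rfl⟩))
    obtain ⟨u, hu, w, hw, huw⟩ := Submodule.mem_sup.1 ((Ideal.eq_top_iff_one _).1 htop)
    obtain ⟨ψ, hψ⟩ := (Ideal.mem_span_range_iff_exists_fun).1 hw
    refine ⟨ψ, ?_⟩
    rw [dotProduct, hψ, ← huw, sub_add_cancel_right]
    exact J.neg_mem hu
  set t := ψ ⬝ᵥ v with ht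
  set K := (Finset.univ.sup fun i => (q i).natDegree) + 1 with hK
  have hqK (i) : (q i).natDegree < K :=
    Nat.lt_succ_of_le (Finset.le_sup (f := fun i => (q i).natDegree) (Finset.mem_univ i))
  set w : A[X] := (X - C 1) * f ^ 2 with hw_def
  have hw : w.Monic := (monic_X_sub_C 1).mul (hf.pow 2)
  obtain ⟨n, rfl⟩ : ∃ l, n = l + 1 := ⟨n - 1, by omega⟩
  obtain ⟨h, hh, hhJ⟩ := exists_forall_isPrime_false k hH (J.map C)
    (ringKrullDim_quotient_map_C_lt (hdim n (by omega))) w fun i => q i + w * (X ^ K * C (v i))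
  set c : Fin L → A[X] := (X ^ K : A[X]) • (fun i => C (v i)) + fun i => C (h i) with hc
  set g : Fin L → A[X] := q + w • c with hg
  have hgi (i) : g i = q i + w * c i := rfl
  have hci (i) : c i = X ^ K * C (v i) + C (h i) := rfl
  have hgH : HasCoeffsIn H g :=
    hq.add ((((hasCoeffsIn_C hv).smul _).add (hasCoeffsIn_C hh)).smul _)
  have hgJ (P : Ideal A[X]) (pP : P.IsPrime) (hgP : ∀ i, g i ∈ P) (hwP : w ∈ P) : J.map C ≤ P :=
    hJI.trans <| hI_le.2 fun i => by
      simpa [hgi] using P.sub_mem (hgP i) (P.mul_mem_right (c i) hwP)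
  set m := w.natDegree + K with hm
  have hcdeg (i) : (c i).natDegree ≤ K := by
    rw [hci]; compute_degree
  have hgdeg (i) : (g i).natDegree ≤ m := by
    refine natDegree_add_le_of_degree_le ((hqK i).le.trans (Nat.le_add_left _ _)) ?_
    exact natDegree_mul_le_of_le le_rfl (hcdeg i)
  have hgm (i) : (g i).coeff m = v i := by
    have h1 : (c i).coeff K = v i := by
      rw [hci, coeff_add, coeff_X_pow_mul', if_pos le_rfl, coeff_C, coeff_C]
      simp [hK]
    rw [hgi, coeff_add, coeff_eq_zero_of_natDegree_lt ((hqK i).trans_le (Nat.le_add_left _ _)),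
      zero_add, hm, coeff_mul_add_eq_of_natDegree_le le_rfl (hcdeg i), h1]
    simp [hw.leadingCoeff]
  set κ := (X - C 1) * (y ⬝ᵥ c) with hκ
  have hyg : y ⬝ᵥ g = f * (1 + f * κ) := by
    rw [hg, dotProduct_add, dotProduct_smul, ← hf_def, smul_eq_mul, hw_def, hκ]; ring
  set 𝔠 : Ideal A[X] := Ideal.span (Set.range g) ⊔ Ideal.span {1 + f * κ} with h𝔠
  have hgc (i) : g i ∈ 𝔠 := le_sup_left (b := Ideal.span {1 + f * κ}) (Ideal.subset_span ⟨i, rfl⟩)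
  have hfc : 1 + f * κ ∈ 𝔠 :=
    le_sup_right (a := Ideal.span (Set.range g)) (Ideal.subset_span rfl)
  have hctop : 𝔠 ⊔ J.map C = ⊤ := by
    by_contra hne
    obtain ⟨P, hP, hle⟩ := Ideal.exists_le_maximal _ hne
    have pP := hP.isPrime
    have hcP : 𝔠 ≤ P := le_sup_left.trans hle
    have hone : (1 : A[X]) ∉ P := (Ideal.ne_top_iff_one P).1 hP.ne_top
    have hfP : f ∉ P := fun hfP => hone <| by
      simpa using P.sub_mem (hcP hfc) (P.mul_mem_right κ hfP)
    refine hhJ P pP (le_sup_right.trans hle) (fun hwP => hfP ?_) fun i => ?_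
    · refine (hI_le.2 fun i => ?_ : I ≤ P) hfI
      simpa [hgi] using P.sub_mem (hcP (hgc i)) (P.mul_mem_right (c i) hwP)
    · have := hcP (hgc i)
      rw [hgi, hci] at this
      convert this using 1
      rw [← algebraMap_eq]; ring
  obtain ⟨τ, hτ, hτJ⟩ : ∃ τ, C τ ∈ 𝔠 ∧ τ - 1 ∈ J := by
    refine exists_C_mem_of_sup_eq_top (F := ∑ i, C (ψ i) * g i) (m := m) (by omega)
      (𝔠.sum_mem fun i _ => 𝔠.mul_mem_left _ (hgc i))
      (natDegree_sum_le_of_forall_le _ _ fun i _ => (natDegree_C_mul_le _ _).trans (hgdeg i)) ?_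
      hctop
    rw [finsetSum_coeff]
    simp only [coeff_C_mul, hgm]
    exact hψ
  set a := 1 - τ * t with ha
  have haJ : a ∈ J := by
    have : a = -((τ - 1) * t + (t - 1)) := by rw [ha]; ring
    exact this ▸ J.neg_mem (J.add_mem (J.mul_mem_right _ hτJ) hψ)
  refine ⟨fun i => ∑ j ∈ Finset.range (m + 1), a ^ (m - j) * (g i).coeff j, ?_, ?_⟩
  · have : (fun i => ∑ j ∈ Finset.range (m + 1), a ^ (m - j) * (g i).coeff j) =
        ∑ j ∈ Finset.range (m + 1), a ^ (m - j) • fun i => (g i).coeff j := by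
      ext i; simp
    rw [this]
    exact H.sum_mem fun j _ => H.smul_mem _ (hgH j)
  by_contra hne
  obtain ⟨M, hM, hle⟩ := Ideal.exists_le_maximal _ hne
  let := Ideal.Quotient.field M
  set φ : A →+* A ⧸ M := Ideal.Quotient.mk M with hφ
  have hp (i) : φ (∑ j ∈ Finset.range (m + 1), a ^ (m - j) * (g i).coeff j) = 0 :=
    Ideal.Quotient.eq_zero_iff_mem.2 (hle (Ideal.subset_span ⟨i, rfl⟩))
  have hφa : φ a = 1 - φ τ * φ t := by rw [ha]; simp
  by_cases ha0 : φ a = 0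
  · have hφt : φ t = 0 := by
      rw [ht, dotProduct, map_sum]
      refine Finset.sum_eq_zero fun i _ => ?_
      have := hp i
      rw [map_sum_pow_mul_coeff_of_eq_zero φ _ _ ha0, hgm] at this
      rw [map_mul, this, mul_zero]
    rw [hφt, mul_zero, sub_zero, ha0] at hφa
    exact zero_ne_one hφa
  let ε : A[X] →+* A ⧸ M := eval₂RingHom φ (φ a)⁻¹
  have hε (z : A) : ε (C z) = φ z := eval₂_C _ _
  have hgP (i) : g i ∈ RingHom.ker ε := by
    have := hp i
    rw [map_sum_pow_mul_coeff φ (hgdeg i) ha0] at this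
    exact (mul_eq_zero.1 this).resolve_left (pow_ne_zero _ ha0)
  have pP : (RingHom.ker ε).IsPrime := RingHom.ker_isPrime ε
  have hwP : w ∈ RingHom.ker ε := by
    by_cases hτ0 : φ τ = 0
    · refine Ideal.mul_mem_right _ _ ?_
      rw [hτ0, zero_mul, sub_zero] at hφa
      simp [ε, RingHom.mem_ker, hφa]
    · refine Ideal.mul_mem_left _ _ (Ideal.pow_mem_of_mem _ ?_ 2 two_pos)
      have h1 : y ⬝ᵥ g ∈ RingHom.ker ε := Ideal.sum_mem _ fun i _ => Ideal.mul_mem_left _ _ (hgP i)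
      rw [hyg] at h1
      refine (pP.mem_or_mem h1).resolve_right fun h2 => hτ0 ?_
      have h3 : 𝔠 ≤ RingHom.ker ε := by
        refine sup_le (Ideal.span_le.2 ?_) ((Ideal.span_singleton_le_iff_mem _).2 h2)
        rintro _ ⟨i, rfl⟩
        exact hgP i
      rw [← hε]
      exact h3 hτ
  refine ha0 ?_
  rw [← hε]
  exact hgJ _ pP hgP hwP (Ideal.mem_map_of_mem _ haJ)

theorem exists_mem_span_range_eq_top (k : Type*) [Field k] [Infinite k]
    [Algebra k A] [IsNoetherianRing A] {d n : ℕ} (hd : ringKrullDim A = d)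
    (hn : d + 3 ≤ 2 * n) {H : Submodule A (Fin L → A)}
    (hH : Ideal.span {b | HasDualFamily H n b} = ⊤) {q y : Fin L → A[X]} (hq : HasCoeffsIn H q)
    (hf : (y ⬝ᵥ q).Monic) :
    ∃ p ∈ H, Ideal.span (Set.range p) = ⊤ := by
  have : Nontrivial A := by
    by_contra hA
    rw [not_nontrivial_iff_subsingleton] at hA
    rw [ringKrullDim_eq_bot_of_subsingleton] at hd
    exact WithBot.bot_ne_coe hd
  obtain ⟨q', hq', hf', hP⟩ := exists_monic_dotProduct_forall_le_height k hH hq hf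
  exact exists_mem_span_range_eq_top_of_forall_le_height k hd hn hH hq' hf' hP

end Core

section Localized
variable {R M : Type*} [CommRing R] [AddCommGroup M] [Module R M] {L : ℕ}

/-- Functionals on a localization of a direct summand of `R ^ L` come, up to a denominator, from
vectors over `R`. -/
theorem exists_algebraMap_dotProduct_eq (S : Submonoid R) {i : M →ₗ[R] Fin L → R}
    {π : (Fin L → R) →ₗ[R] M} (hπ : ∀ x, π (i x) = x) {ι : Type*} [Finite ι]
    (ω : ι → LocalizedModule S M →ₗ[Localization S] Localization S) :
    ∃ s ∈ S, ∃ y : ι → Fin L → R, ∀ j x, algebraMap R (Localization S) (y j ⬝ᵥ i x) =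
      algebraMap R (Localization S) s * ω j (LocalizedModule.mkLinearMap S M x) := by
  let ω' (j : ι) : M →ₗ[R] Localization S :=
    ((ω j).restrictScalars R).comp (LocalizedModule.mkLinearMap S M)
  obtain ⟨s, hs⟩ := IsLocalization.exist_integer_multiples_of_finite S
    fun jl : ι × Fin L => ω' jl.1 (π (Pi.single jl.2 1))
  choose y hy using hs
  refine ⟨s, s.2, fun j l => y (j, l), fun j x => ?_⟩
  change _ = algebraMap R (Localization S) s * ω' j x
  conv_rhs => rw [← hπ x, pi_eq_sum_univ' (i x)]
  rw [dotProduct, map_sum, map_sum, map_sum, Finset.mul_sum]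
  refine Finset.sum_congr rfl fun l _ => ?_
  rw [map_mul, hy, map_smul, map_smul, Algebra.smul_def, Algebra.smul_def]
  ring

theorem exists_dotProduct_mem_of_hasUnimodular {S : Submonoid R} {i : M →ₗ[R] Fin L → R}
    {π : (Fin L → R) →ₗ[R] M} (hπ : ∀ x, π (i x) = x)
    (h : HasUnimodular (Localization S) (LocalizedModule S M)) :
    ∃ (y : Fin L → R) (x : M), y ⬝ᵥ i x ∈ S := by
  obtain ⟨m, φ, hφ⟩ := h
  obtain ⟨⟨x, c⟩, hx⟩ := IsLocalizedModule.surj S (LocalizedModule.mkLinearMap S M) m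
  obtain ⟨s, hs, y, hy⟩ := exists_algebraMap_dotProduct_eq S hπ fun _ : Unit => φ
  have h1 := hy () x
  have h2 : φ (LocalizedModule.mkLinearMap S M x) = algebraMap R _ (c : R) := by
    rw [← hx]
    change φ ((c : R) • m) = _
    rw [← algebraMap_smul (Localization S), map_smul, hφ, smul_eq_mul, mul_one]
  rw [h2, ← map_mul] at h1
  obtain ⟨u, hu⟩ := IsLocalization.exists_of_eq (M := S) h1
  refine ⟨(u : R) • y (), x, ?_⟩
  rw [smul_dotProduct, smul_eq_mul, hu]
  exact S.mul_mem u.2 (S.mul_mem hs c.2)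

theorem span_hasDualFamily_range_eq_top [Module.Finite R M] [Module.Projective R M]
    {i : M →ₗ[R] Fin L → R} {π : (Fin L → R) →ₗ[R] M} (hπ : ∀ x, π (i x) = x) {n : ℕ}
    (hM : ∀ p : PrimeSpectrum R, Module.rankAtStalk M p = n) :
    Ideal.span {b | HasDualFamily (LinearMap.range i) n b} = ⊤ := by
  by_contra hne
  obtain ⟨p, hp, hle⟩ := Ideal.exists_le_maximal _ hne
  have pp := hp.isPrime
  set S := p.primeCompl
  have : Module.Free (Localization S) (LocalizedModule S M) :=
    Module.free_of_flat_of_isLocalRing (R := Localization.AtPrime p)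
  let b := Module.finBasisOfFinrankEq (Localization S) (LocalizedModule S M) (hM ⟨p, pp⟩)
  obtain ⟨s, hs, y, hy⟩ := exists_algebraMap_dotProduct_eq S hπ b.coord
  obtain ⟨s', hs'⟩ := IsLocalizedModule.exist_integer_multiples_of_finite S
    (LocalizedModule.mkLinearMap S M) b
  choose x hx using hs'
  have key (j k) : ∃ u : S, (u : R) * (y j ⬝ᵥ i (x k)) = u * if k = j then s * s' else 0 := by
    refine IsLocalization.exists_of_eq (M := S) (S := Localization S) ?_
    rw [hy, hx, ← algebraMap_smul (Localization S), map_smul, Module.Basis.coord_apply,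
      b.repr_self, Finsupp.single_apply, smul_eq_mul]
    split_ifs <;> simp
  choose u hu using key
  set U := ∏ j, ∏ k, (u j k : R) with hU
  have hUS : U ∈ S := S.prod_mem fun j _ => S.prod_mem fun k _ => (u j k).2
  have hdual : HasDualFamily (LinearMap.range i) n (U * (s * s')) := by
    refine ⟨fun k => i (U • x k), y, fun k => ⟨_, rfl⟩, fun k j => ?_⟩
    change y j ⬝ᵥ i (U • x k) = _
    rw [map_smul, dotProduct_smul, smul_eq_mul]
    have : (u j k : R) ∣ U :=
      (Finset.dvd_prod_of_mem (fun k => (u j k : R)) (Finset.mem_univ k)).trans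
      (Finset.dvd_prod_of_mem (fun j => ∏ k, (u j k : R)) (Finset.mem_univ j))
    obtain ⟨v, hv⟩ := this
    have := hu j k
    split_ifs at this ⊢ with h
    · rw [hv]; linear_combination v * this
    · rw [hv]; linear_combination v * this
  exact S.mul_mem hUS (S.mul_mem hs s'.2) (hle (Ideal.subset_span hdual))

end Localized

section Extended
variable {A B Q : Type*} [CommRing A] [CommRing B] [Algebra A B] [AddCommGroup Q] [Module A Q]
  {L : ℕ}

/-- The coordinates on `B ⊗[A] Q` induced by a linear map from `Q` to `A ^ L`. -/
noncomputable def baseChangeCoords (B : Type*) [CommRing B] [Algebra A B] (i : Q →ₗ[A] Fin L → A) :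
    B ⊗[A] Q →ₗ[B] Fin L → B :=
  LinearMap.pi fun l =>
    (AlgebraTensorModule.rid A B B).toLinearMap ∘ₗ ((LinearMap.proj l ∘ₗ i).baseChange B)

theorem baseChangeCoords_tmul (i : Q →ₗ[A] Fin L → A) (b : B) (x : Q) (l : Fin L) :
    baseChangeCoords B i (b ⊗ₜ x) l = b * algebraMap A B (i x l) := by
  simp [baseChangeCoords, Algebra.smul_def, mul_comm]

theorem exists_baseChangeCoords_leftInverse {i : Q →ₗ[A] Fin L → A} {π : (Fin L → A) →ₗ[A] Q}
    (hπ : ∀ x, π (i x) = x) :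
    ∃ ρ : (Fin L → B) →ₗ[B] B ⊗[A] Q, ∀ z, ρ (baseChangeCoords B i z) = z := by
  refine ⟨Fintype.linearCombination B fun l => (1 : B) ⊗ₜ[A] π (Pi.single l 1), fun z => ?_⟩
  induction z using TensorProduct.induction_on with
  | zero => simp
  | add z z' hz hz' => rw [map_add, map_add, hz, hz']
  | tmul b x =>
    rw [Fintype.linearCombination_apply]
    conv_rhs => rw [← hπ x, pi_eq_sum_univ' (i x), map_sum, tmul_sum]
    refine Finset.sum_congr rfl fun l _ => ?_
    rw [baseChangeCoords_tmul, map_smul, smul_tmul', smul_eq_mul, mul_one, ← smul_tmul,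
      Algebra.smul_def, mul_comm]

theorem hasCoeffsIn_baseChangeCoords (θ : B →ₐ[A] A[X]) (i : Q →ₗ[A] Fin L → A) (z : B ⊗[A] Q) :
    HasCoeffsIn (LinearMap.range i) (fun l => θ (baseChangeCoords B i z l)) := by
  induction z using TensorProduct.induction_on with
  | zero =>
    intro j
    simp only [map_zero, Pi.zero_apply, coeff_zero]
    exact Submodule.zero_mem _
  | add z z' hz hz' =>
    have := hz.add hz'
    simpa [Pi.add_def] using this
  | tmul b x =>
    have := (hasCoeffsIn_C (LinearMap.mem_range_self i x)).smul (θ b)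
    convert this using 2 with l
    simp [baseChangeCoords_tmul]

theorem hasUnimodular_of_localized_extended (k : Type*) [Field k] [Infinite k] [Algebra k A]
    [IsNoetherianRing A] {d n : ℕ} (hd : ringKrullDim A = d) (hn : d + 3 ≤ 2 * n)
    [Module.Finite A Q] [Module.Projective A Q] {P : Type*} [AddCommGroup P] [Module B P]
    (hP : HasRank B P n) (e : P ≃ₗ[B] B ⊗[A] Q) (θ : B →ₐ[A] A[X]) {f : B} (hf : (θ f).Monic)
    (h : HasUnimodular (Localization (Submonoid.powers f))
      (LocalizedModule (Submonoid.powers f) P)) :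
    HasUnimodular B P := by
  obtain ⟨L, π, i, -, -, hπi⟩ := Module.Finite.exists_comp_eq_id_of_projective A Q
  have hπ (x) : π (i x) = x := LinearMap.congr_fun hπi x
  obtain ⟨ρ, hρ⟩ := exists_baseChangeCoords_leftInverse (B := B) hπ
  have hQ (p : PrimeSpectrum A) : Module.rankAtStalk Q p = n := by
    let ev : B →ₐ[A] A := (aeval (0 : A)).comp θ
    let p' : PrimeSpectrum B := p.comap ev.toRingHom
    have hp' : p'.comap (algebraMap A B) = p := by
      ext a
      simp [p', PrimeSpectrum.comap]
    rw [← hp', ← Module.rankAtStalk_baseChange, ← Module.rankAtStalk_eq_of_equiv e,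
      Module.rankAtStalk, Module.finrank, hP p', Cardinal.toNat_natCast]
  obtain ⟨y, x, a, hyx⟩ := exists_dotProduct_mem_of_hasUnimodular
    (i := baseChangeCoords B i ∘ₗ e.toLinearMap) (π := e.symm.toLinearMap ∘ₗ ρ)
    (fun x => by simp [hρ]) h
  obtain ⟨_, ⟨q, rfl⟩, hq⟩ := exists_mem_span_range_eq_top k hd hn
    (span_hasDualFamily_range_eq_top hπ hQ) (hasCoeffsIn_baseChangeCoords θ i (e x))
    (y := fun l => θ (y l)) (by
      have : (fun l => θ (y l)) ⬝ᵥ (fun l => θ (baseChangeCoords B i (e x) l)) = θ f ^ a := by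
        rw [← map_pow]
        change _ = θ ((fun a => f ^ a) a)
        rw [hyx]
        simp [dotProduct]
      exact this ▸ hf.pow a)
  obtain ⟨z, hz⟩ := Ideal.mem_span_range_iff_exists_fun.1 ((Ideal.eq_top_iff_one _).1 hq)
  refine ⟨e.symm (1 ⊗ₜ q), (∑ l, algebraMap A B (z l) • LinearMap.proj l) ∘ₗ
    baseChangeCoords B i ∘ₗ e.toLinearMap, ?_⟩
  have := congrArg (algebraMap A B) hz
  rw [map_one, map_sum] at this
  simpa [baseChangeCoords_tmul, Algebra.smul_def] using this

end Extended

end UnimodularDescent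

universe u v

/-- (Theorem 6.1, case 1) Let `A` be Noetherian of dimension `d` containing an infinite field
`k`, and `P` a finitely generated projective module of rank `n`, `2n ≥ d + 3`, over
`A[T₁,…,T_r] = (A[T₁,…,T_{r−1}])[T_r]`, extended from `A`.  If `P_f` has a unimodular element
for some `f` monic in `T_r`, then `P` has a unimodular element. -/
theorem stmt11 (k A : Type u) [Field k] [Infinite k] [CommRing A] [IsNoetherianRing A]
    [Algebra k A] (d n r : ℕ) (hr : 1 ≤ r)
    (hdim : ringKrullDim A = d) (hn : d + 3 ≤ 2 * n)
    (P : Type v) [AddCommGroup P]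
    [Module (Polynomial (MvPolynomial (Fin (r - 1)) A)) P]
    [Module.Finite (Polynomial (MvPolynomial (Fin (r - 1)) A)) P]
    [Module.Projective (Polynomial (MvPolynomial (Fin (r - 1)) A)) P]
    (hrank : HasRank (Polynomial (MvPolynomial (Fin (r - 1)) A)) P n)
    (hext : ∃ (Q : Type u) (_ : AddCommGroup Q) (_ : Module A Q),
      Module.Finite A Q ∧ Module.Projective A Q ∧
      Nonempty (P ≃ₗ[Polynomial (MvPolynomial (Fin (r - 1)) A)]
        ((Polynomial (MvPolynomial (Fin (r - 1)) A)) ⊗[A] Q)))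
    (f : Polynomial (MvPolynomial (Fin (r - 1)) A)) (hf : f.Monic)
    (h : HasUnimodular (Localization (Submonoid.powers f))
      (LocalizedModule (Submonoid.powers f) P)) :
    HasUnimodular (Polynomial (MvPolynomial (Fin (r - 1)) A)) P := by
  obtain ⟨Q, _, _, _, _, ⟨e⟩⟩ := hext
  exact hasUnimodular_of_localized_extended k hdim hn hrank e
    (Polynomial.mapAlgHom (MvPolynomial.aeval (0 : Fin (r - 1) → A))) (hf.map _) h
end

section
/- Let R be a commutative Noetherian ring of dimension d, n an integer with 2n ≥ d + 3, I ⊆ R[T] an ideal of height n with I + 𝒥(R)·R[T] = R[T], where 𝒥(R) is the Jacobson radical of R and ht 𝒥(R) ≥ d − n + 2. Let P be a finitely generated projective R-module of rank n and φ : P[T] ↠ I/I² a surjection. If φ ⊗ R(T) : P(T) ↠ I·R(T)/I²·R(T) can be lifted to a surjection P(T) ↠ I·R(T), then φ can be lifted to a surjection Φ : P[T] ↠ I. -/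
open TensorProduct Polynomial

/-- The multiplicative set of monic polynomials; `R(T)` is the localization of `R[T]` at it. -/
def monicSubmonoid (R : Type*) [CommRing R] : Submonoid (Polynomial R) where
  carrier := {f | f.Monic}
  mul_mem' := fun ha hb => ha.mul hb
  one_mem' := monic_one

section StableRange

variable {D : Type*} [CommRing D]

/-- Pairwise incomparable primes admit elements lying outside exactly one of them. -/
theorem exists_selectors_of_isAntichain (F : Finset (Ideal D)) (hF : ∀ p ∈ F, p.IsPrime)
    (hanti : ∀ p ∈ F, ∀ q ∈ F, q ≤ p → q = p) :
    ∃ x : Ideal D → D, ∀ p ∈ F, x p ∉ p ∧ ∀ q ∈ F, q ≠ p → x p ∈ q := by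
  classical
  have key : ∀ p, ∃ x : D, p ∈ F → (x ∉ p ∧ ∀ q ∈ F, q ≠ p → x ∈ q) := by
    intro p
    by_cases hp : p ∈ F
    · have hex : ∀ q, ∃ a : D, q ∈ F → q ≠ p → (a ∈ q ∧ a ∉ p) := by
        intro q
        by_cases hq : q ∈ F ∧ q ≠ p
        · obtain ⟨a, ha, ha'⟩ := SetLike.not_le_iff_exists.1
            (fun hle => hq.2 (hanti p hp q hq.1 hle))
          exact ⟨a, fun _ _ => ⟨ha, ha'⟩⟩
        · exact ⟨0, fun h1 h2 => absurd ⟨h1, h2⟩ hq⟩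
      choose a ha using hex
      refine ⟨∏ q ∈ F.erase p, a q, fun _ => ⟨?_, fun q hq hqp => ?_⟩⟩
      · have := hF p hp
        rw [Ideal.IsPrime.prod_mem_iff]
        rintro ⟨q, hq, hqm⟩
        exact (ha q (Finset.mem_of_mem_erase hq) (Finset.ne_of_mem_erase hq)).2 hqm
      · exact Ideal.mem_of_dvd _ (Finset.dvd_prod_of_mem a (Finset.mem_erase.2 ⟨hqp, hq⟩))
          (ha q hq hqp).1
    · exact ⟨0, fun h => absurd h hp⟩
  choose x hx using key
  exact ⟨x, fun p hp => hx p hp⟩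

theorem exists_add_mul_notMem_of_isAntichain (F : Finset (Ideal D))
    (hF : ∀ p ∈ F, p.IsPrime) (hanti : ∀ p ∈ F, ∀ q ∈ F, q ≤ p → q = p) (z γ : D)
    (hγ : ∀ p ∈ F, γ ∉ p) : ∃ a : D, ∀ p ∈ F, z + γ * a ∉ p := by
  classical
  obtain ⟨x, hx⟩ := exists_selectors_of_isAntichain F hF hanti
  refine ⟨∑ q ∈ F.filter (fun q => z ∈ q), x q, fun p hp hmem => ?_⟩
  have hpp := hF p hp
  by_cases hz : z ∈ p
  · rw [← Finset.add_sum_erase _ x (Finset.mem_filter.2 ⟨hp, hz⟩)] at hmem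
    have h1 : ∑ q ∈ (F.filter (fun q => z ∈ q)).erase p, x q ∈ p := by
      refine Ideal.sum_mem _ fun q hq => ?_
      have hqF := (Finset.mem_filter.1 (Finset.mem_of_mem_erase hq)).1
      exact (hx q hqF).2 p hp (Finset.ne_of_mem_erase hq).symm
    have h2 : γ * (x p + ∑ q ∈ (F.filter (fun q => z ∈ q)).erase p, x q) ∈ p :=
      (Ideal.add_mem_iff_right p hz).1 hmem
    rcases hpp.mem_or_mem h2 with h3 | h3
    · exact hγ p hp h3
    · exact (hx p hp).1 ((Ideal.add_mem_iff_left p h1).1 h3)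
  · have h1 : ∑ q ∈ F.filter (fun q => z ∈ q), x q ∈ p := by
      refine Ideal.sum_mem _ fun q hq => ?_
      obtain ⟨hqF, hzq⟩ := Finset.mem_filter.1 hq
      exact (hx q hqF).2 p hp (fun h => hz (h ▸ hzq))
    exact hz ((Ideal.add_mem_iff_left p (Ideal.mul_mem_left p γ h1)).1 hmem)

theorem eq_of_le_of_mem_minimalPrimes {I p q : Ideal D} (hp : p ∈ I.minimalPrimes)
    (hq : q ∈ I.minimalPrimes) (hqp : q ≤ p) : q = p :=
  le_antisymm hqp (hp.2 hq.1 hqp)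

/-- Away from `γ`, the elements `z j` can be shifted by multiples of `γ` so that their common
vanishing locus in `V(𝔞)` has codimension at least `r`, measured by `δ`. -/
theorem exists_forall_add_mul_mem_imp_le [IsNoetherianRing D] (𝔞 : Ideal D) (δ : Ideal D → ℕ)
    (hδ : ∀ p q : Ideal D, p.IsPrime → q.IsPrime → 𝔞 ≤ p → p < q → δ p < δ q)
    (γ : D) (z : ℕ → D) (r : ℕ) :
    ∃ a : ℕ → D, ∀ p : Ideal D, p.IsPrime → 𝔞 ≤ p → γ ∉ p →
      (∀ j < r, z j + γ * a j ∈ p) → r ≤ δ p := by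
  classical
  induction r with
  | zero => exact ⟨0, fun _ _ _ _ _ => Nat.zero_le _⟩
  | succ r ih =>
    obtain ⟨a, ha⟩ := ih
    let 𝔟 : Ideal D := 𝔞 ⊔ Ideal.span {x | ∃ j < r, x = z j + γ * a j}
    have hfin := 𝔟.finite_minimalPrimes_of_isNoetherianRing
    let F : Finset (Ideal D) := hfin.toFinset.filter (fun p => γ ∉ p)
    have hFm : ∀ p ∈ F, p ∈ 𝔟.minimalPrimes := fun p hp =>
      hfin.mem_toFinset.1 (Finset.mem_filter.1 hp).1
    obtain ⟨b, hb⟩ := exists_add_mul_notMem_of_isAntichain F (fun p hp => (hFm p hp).1.1)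
      (fun p hp q hq h => eq_of_le_of_mem_minimalPrimes (hFm p hp) (hFm q hq) h)
      (z r) γ (fun p hp => (Finset.mem_filter.1 hp).2)
    refine ⟨Function.update a r b, fun p hp hap hγp hz => ?_⟩
    have hbp : 𝔟 ≤ p := by
      refine sup_le hap (Ideal.span_le.2 ?_)
      rintro _ ⟨j, hj, rfl⟩
      have := hz j (by omega)
      rwa [Function.update_of_ne (by omega)] at this
    obtain ⟨p₀, hp₀, hle⟩ := Ideal.exists_minimalPrimes_le hbp
    have hγ₀ : γ ∉ p₀ := fun h => hγp (hle h)
    have hr : r ≤ δ p₀ := by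
      refine ha p₀ hp₀.1.1 (le_sup_left.trans hp₀.1.2) hγ₀ fun j hj => hp₀.1.2 ?_
      exact Ideal.mem_sup_right (Ideal.subset_span ⟨j, hj, rfl⟩)
    have hne : p₀ ≠ p := by
      rintro rfl
      have h1 := hz r (by omega)
      rw [Function.update_self] at h1
      exact hb p₀ (Finset.mem_filter.2 ⟨hfin.mem_toFinset.2 hp₀, hγ₀⟩) h1
    exact lt_of_le_of_lt hr (hδ p₀ p hp₀.1.1 hp (le_sup_left.trans hp₀.1.2)
      (lt_of_le_of_ne hle hne))

variable {M : Type*} [AddCommGroup M] [Module D M]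

/-- A module of local rank at least `r` has a family of `r` vectors and functionals which is
dual up to a factor `w` avoiding the minimal primes of `𝔞`. -/
theorem exists_biorthogonal_notMem_minimalPrimes [IsNoetherianRing D] (𝔞 : Ideal D) {r : ℕ}
    (hM : ∀ p : Ideal D, p.IsPrime → ∃ (e : Fin r → M) (l : Fin r → M →ₗ[D] D),
      (Matrix.of fun i j => l i (e j)).det ∉ p) :
    ∃ (e : Fin r → M) (l : Fin r → M →ₗ[D] D) (w : D),
      (∀ i j, l i (e j) = if i = j then w else 0) ∧ ∀ p ∈ 𝔞.minimalPrimes, w ∉ p := by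
  classical
  have hfin := 𝔞.finite_minimalPrimes_of_isNoetherianRing
  let F : Finset (Ideal D) := hfin.toFinset
  have hFm : ∀ p ∈ F, p ∈ 𝔞.minimalPrimes := fun p hp => hfin.mem_toFinset.1 hp
  obtain ⟨x, hx⟩ := exists_selectors_of_isAntichain F (fun p hp => (hFm p hp).1.1)
      (fun p hp q hq h => eq_of_le_of_mem_minimalPrimes (hFm p hp) (hFm q hq) h)
  have hM' : ∀ p : Ideal D, ∃ (e : Fin r → M) (l : Fin r → M →ₗ[D] D), p.IsPrime →
      (Matrix.of fun i j => l i (e j)).det ∉ p := by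
    intro p
    by_cases hp : p.IsPrime
    · obtain ⟨e, l, h⟩ := hM p hp
      exact ⟨e, l, fun _ => h⟩
    · exact ⟨0, 0, fun h => absurd h hp⟩
  choose e l hel using hM'
  let e' : Fin r → M := fun j => ∑ p ∈ F, x p • e p j
  let l' : Fin r → M →ₗ[D] D := fun i => ∑ p ∈ F, x p • l p i
  let G : Matrix (Fin r) (Fin r) D := Matrix.of fun i j => l' i (e' j)
  have hG : ∀ p ∈ F, G.det ∉ p := by
    intro p hp hmem
    have hpp := (hFm p hp).1.1
    have hxq : ∀ q ∈ F, q ≠ p → Ideal.Quotient.mk p (x q) = 0 := fun q hq hqp =>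
      Ideal.Quotient.eq_zero_iff_mem.2 ((hx q hq).2 p hp hqp.symm)
    have hent : (Ideal.Quotient.mk p).mapMatrix G = (Ideal.Quotient.mk p (x p) ^ 2) •
        (Ideal.Quotient.mk p).mapMatrix (Matrix.of fun i j => l p i (e p j)) := by
      ext i j
      simp only [G, l', e', RingHom.mapMatrix_apply, Matrix.map_apply, Matrix.of_apply,
        Matrix.smul_apply, LinearMap.sum_apply, LinearMap.smul_apply, map_sum, map_smul,
        smul_eq_mul, map_mul]
      rw [Finset.sum_eq_single p, Finset.sum_eq_single p]
      · ring
      · intro q hq hqp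
        rw [hxq q hq hqp, zero_mul]
      · exact fun h => absurd hp h
      · intro q hq hqp
        rw [hxq q hq hqp, zero_mul]
      · exact fun h => absurd hp h
    have h0 := Ideal.Quotient.eq_zero_iff_mem.2 hmem
    rw [RingHom.map_det, hent, Matrix.det_smul, ← RingHom.map_det, ← map_pow, ← map_pow, ← map_mul,
      Ideal.Quotient.eq_zero_iff_mem] at h0
    rcases hpp.mem_or_mem h0 with h | h
    · exact (hx p hp).1 (hpp.mem_of_pow_mem _ (hpp.mem_of_pow_mem _ h))
    · exact hel p hpp h
  refine ⟨e', fun i => (∑ k, G.adjugate i k • l' k : M →ₗ[D] D), G.det, fun i j => ?_, fun p hp =>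
    hG p (hfin.mem_toFinset.2 hp)⟩
  have h := congrFun (congrFun (Matrix.adjugate_mul G) i) j
  rw [Matrix.mul_apply, Matrix.smul_apply, Matrix.one_apply] at h
  simp only [LinearMap.sum_apply, LinearMap.smul_apply, smul_eq_mul]
  rw [show (∑ k, G.adjugate i k * l' k (e' j)) = ∑ k, G.adjugate i k * G k j from rfl, h]
  simp

/-- A stable range theorem: if `(q, c)` is unimodular on a set `X` of primes of dimension less than
the local rank of `M`, then so is `q + c • y` for some functional `y`. -/
theorem exists_forall_exists_add_mul_notMem [IsNoetherianRing D] {r : ℕ}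
    (hM : ∀ p : Ideal D, p.IsPrime → ∃ (e : Fin r → M) (l : Fin r → M →ₗ[D] D),
      (Matrix.of fun i j => l i (e j)).det ∉ p)
    (s : ℕ) (hs : s ≤ r) (𝔞 : Ideal D) (δ : Ideal D → ℕ)
    (hδ : ∀ p q : Ideal D, p.IsPrime → q.IsPrime → 𝔞 ≤ p → p < q → δ p < δ q)
    (X : Set (Ideal D)) (hX : ∀ p ∈ X, p.IsPrime ∧ 𝔞 ≤ p ∧ δ p < s)
    (q : M →ₗ[D] D) (c : D) (hq : ∀ p ∈ X, c ∈ p → ∃ m, q m ∉ p) :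
    ∃ y : M →ₗ[D] D, ∀ p ∈ X, ∃ m, q m + c * y m ∉ p := by
  classical
  induction s generalizing 𝔞 δ X q with
  | zero => exact ⟨0, fun p hp => absurd (hX p hp).2.2 (Nat.not_lt_zero _)⟩
  | succ s ih =>
    obtain ⟨e, l, w, hel, hw⟩ := exists_biorthogonal_notMem_minimalPrimes 𝔞 hM
    have hpos : ∀ p : Ideal D, p.IsPrime → 𝔞 ⊔ Ideal.span {w} ≤ p → 1 ≤ δ p := by
      intro p hp hle
      obtain ⟨p₀, hp₀, hle₀⟩ := Ideal.exists_minimalPrimes_le (le_sup_left.trans hle)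
      have hwp : w ∈ p := hle (Ideal.mem_sup_right (Ideal.mem_span_singleton_self w))
      have := hδ p₀ p hp₀.1.1 hp hp₀.1.2
        (lt_of_le_of_ne hle₀ (by rintro rfl; exact hw _ hp₀ hwp))
      omega
    obtain ⟨y₀, hy₀⟩ := ih (by omega) (𝔞 ⊔ Ideal.span {w}) (fun p => δ p - 1)
      (fun p q hp hq' hle hlt => by
        have h1 := hpos p hp hle
        have h2 := hδ p q hp hq' (le_sup_left.trans hle) hlt
        show δ p - 1 < δ q - 1
        omega)
      {p | p ∈ X ∧ w ∈ p}
      (fun p hp => by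
        obtain ⟨h1, h2, h3⟩ := hX p hp.1
        have hle : 𝔞 ⊔ Ideal.span {w} ≤ p :=
          sup_le h2 ((Ideal.span_singleton_le_iff_mem _).2 hp.2)
        have h4 := hpos p h1 hle
        exact ⟨h1, hle, by show δ p - 1 < s; omega⟩)
      q (fun p hp => hq p hp.1)
    obtain ⟨a, ha⟩ := exists_forall_add_mul_mem_imp_le 𝔞 δ hδ (c * w ^ 2)
      (fun j => if h : j < r then q (e ⟨j, h⟩) + c * y₀ (e ⟨j, h⟩) else 0) r
    refine ⟨y₀ + w • ∑ j : Fin r, a j • l j, fun p hp => ?_⟩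
    by_contra! hcon
    obtain ⟨hpp, hap, hδp⟩ := hX p hp
    have hcp : c ∉ p := fun hc => by
      obtain ⟨m, hm⟩ := hq p hp hc
      exact hm ((Ideal.add_mem_iff_left p (Ideal.mul_mem_right _ p hc)).1 (hcon m))
    have hwp : w ∉ p := fun hwm => by
      obtain ⟨m, hm⟩ := hy₀ p ⟨hp, hwm⟩
      have h := hcon m
      simp only [LinearMap.add_apply, LinearMap.smul_apply, smul_eq_mul, mul_add] at h
      rw [← add_assoc] at h
      exact hm ((Ideal.add_mem_iff_left p
        (Ideal.mul_mem_left p _ (Ideal.mul_mem_right _ p hwm))).1 h)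
    have := ha p hpp hap (fun h => (hpp.mem_or_mem h).elim hcp
      (fun h => hwp (hpp.mem_of_pow_mem _ h))) (fun j hj => by
        have h := hcon (e ⟨j, hj⟩)
        simp only [LinearMap.add_apply, LinearMap.smul_apply, LinearMap.sum_apply, smul_eq_mul,
          hel] at h
        rw [Finset.sum_eq_single (⟨j, hj⟩ : Fin r) (fun b _ hb => by simp [hb])
          (fun h => absurd (Finset.mem_univ _) h)] at h
        simp only [if_true] at h
        rw [dif_pos hj]
        convert h using 1
        ring)
    omega

end StableRange

/-- An element of `1 + 𝒥(R)R[X]` is coprime to every monic polynomial. -/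
theorem isCoprime_of_sub_one_mem_map_jacobson {R : Type*} [CommRing R] {s f : R[X]}
    (hs : s - 1 ∈ ((⊥ : Ideal R).jacobson).map (algebraMap R R[X])) (hf : f.Monic) :
    IsCoprime s f := by
  rw [← Ideal.isCoprime_span_singleton_iff, Ideal.isCoprime_iff_sup_eq]
  by_contra hne
  obtain ⟨𝔪, h𝔪, hle⟩ := Ideal.exists_le_maximal _ hne
  have hs𝔪 : s ∈ 𝔪 := hle (Ideal.mem_sup_left (Ideal.mem_span_singleton_self s))
  have hf𝔪 : f ∈ 𝔪 := hle (Ideal.mem_sup_right (Ideal.mem_span_singleton_self f))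
  have hint : ((Ideal.Quotient.mk 𝔪).comp (algebraMap R R[X])).IsIntegral :=
    hf.quotient_isIntegral hf𝔪
  have hbot : (⊥ : Ideal (R[X] ⧸ 𝔪)).IsMaximal := by
    have := Ideal.Quotient.field 𝔪
    exact (Ideal.bot_quotient_isMaximal_iff 𝔪).2 h𝔪
  have hmax := Ideal.isMaximal_comap_of_isIntegral_of_isMaximal' _ hint ⊥
  rw [← Ideal.comap_comap, ← RingHom.ker_eq_comap_bot, Ideal.mk_ker] at hmax
  have hJ : ((⊥ : Ideal R).jacobson).map (algebraMap R R[X]) ≤ 𝔪 :=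
    Ideal.map_le_iff_le_comap.2 (sInf_le ⟨bot_le, hmax⟩)
  refine h𝔪.ne_top ((Ideal.eq_top_iff_one _).2 ?_)
  have := 𝔪.sub_mem hs𝔪 (hJ hs)
  simpa using this

/-- A prime of `R[X]` containing no monic polynomial has height at most `dim R`. -/
theorem Polynomial.height_le_of_forall_notMem_monic {R : Type*} [CommRing R] [IsNoetherianRing R]
    {d : ℕ} (hdim : ringKrullDim R = d) (p : Ideal R[X]) [p.IsPrime]
    (hp : ∀ f ∈ p, ¬ f.Monic) : p.height ≤ d := by
  by_contra! hlt
  have hdimA : ringKrullDim R[X] = ((d + 1 : ℕ) : WithBot ℕ∞) := by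
    rw [Polynomial.ringKrullDim_of_isNoetherianRing, hdim]; rfl
  have hle : (p.height : WithBot ℕ∞) ≤ ringKrullDim R[X] :=
    Ideal.height_le_ringKrullDim_of_ne_top (Ideal.IsPrime.ne_top ‹_›)
  have hheq : p.height = (d + 1 : ℕ) := by
    refine le_antisymm ?_ ?_
    · rw [hdimA] at hle
      exact_mod_cast hle
    · push_cast
      exact Order.add_one_le_of_lt hlt
  have : FiniteRingKrullDim R[X] := by
    rw [finiteRingKrullDim_iff_ne_bot_and_top, hdimA]
    exact ⟨by exact_mod_cast WithBot.coe_ne_bot,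
      fun h => ENat.natCast_ne_top _ (WithBot.coe_injective h)⟩
  have : FiniteRingKrullDim R := by
    rw [finiteRingKrullDim_iff_ne_bot_and_top, hdim]
    exact ⟨by exact_mod_cast WithBot.coe_ne_bot,
      fun h => ENat.natCast_ne_top _ (WithBot.coe_injective h)⟩
  have hmax : p.IsMaximal := Ideal.isMaximal_of_height_eq_ringKrullDim (by rw [hheq, hdimA]; rfl)
  let q : Ideal R := p.under R
  have : p.LiesOver q := ⟨rfl⟩
  have hq : q.height + 1 = d + 1 := by
    rw [← Polynomial.height_eq_height_add_one q p, hheq]; rfl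
  have hq' : q.height = d := by
    have hfin : q.height ≠ ⊤ := by
      intro h
      rw [h] at hq
      exact absurd hq (by exact_mod_cast (ENat.natCast_ne_top (d + 1)).symm)
    lift q.height to ℕ using hfin with k
    exact_mod_cast Nat.add_right_cancel (by exact_mod_cast hq)
  have hqp : q.IsPrime := inferInstanceAs (p.under R).IsPrime
  have hqmax : q.IsMaximal := Ideal.isMaximal_of_height_eq_ringKrullDim (by rw [hq', hdim]; rfl)
  have hne : p ≠ (p.comap C).map C := by
    intro h
    have h1 := Polynomial.height_map_C q
    rw [show q.map C = p from h.symm, hheq, hq'] at h1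
    exact absurd h1 (by exact_mod_cast (Nat.succ_ne_self d))
  obtain ⟨f, hf, hfp⟩ := Polynomial.exists_monic_span_sup_map_eq R p hqmax hne
  refine hp f ?_ hf
  rw [hfp]
  exact Ideal.mem_sup_right (Ideal.mem_span_singleton_self f)

theorem Module.exists_det_notMem_of_rankAtStalk {D M : Type*} [CommRing D] [AddCommGroup M]
    [Module D M] [Module.Finite D M] [Module.Projective D M] {r : ℕ} (p : Ideal D)
    [hp : p.IsPrime] (hr : Module.rankAtStalk (R := D) M ⟨p, hp⟩ = r) :
    ∃ (e : Fin r → M) (l : Fin r → M →ₗ[D] D), (Matrix.of fun i j => l i (e j)).det ∉ p := by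
  have := Module.finitePresentation_of_projective D M
  have : Module.Free (Localization.AtPrime p) (LocalizedModule p.primeCompl M) :=
    Module.mem_freeLocus.1 (Set.eq_univ_iff_forall.1 Module.freeLocus_eq_univ ⟨p, hp⟩)
  let b : Module.Basis (Fin r) (Localization.AtPrime p) (LocalizedModule p.primeCompl M) :=
    Module.finBasisOfFinrankEq _ _ hr
  let mk := LocalizedModule.mkLinearMap p.primeCompl M
  have h1 : ∀ j, ∃ x : M × p.primeCompl, x.2 • b j = mk x.1 := fun j =>
    IsLocalizedModule.surj p.primeCompl mk (b j)
  choose e he using h1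
  have h2 : ∀ i, ∃ (l : M →ₗ[D] D) (s : p.primeCompl),
      Algebra.linearMap D (Localization.AtPrime p) ∘ₗ l = s • (b.coord i).restrictScalars D ∘ₗ mk :=
    fun i => Module.FinitePresentation.exists_lift_of_isLocalizedModule p.primeCompl _ _
  choose l s hl using h2
  refine ⟨fun j => (e j).1, l, fun hmem => ?_⟩
  have h3 : (algebraMap D (Localization.AtPrime p)).mapMatrix
      (Matrix.of fun i j => l i (e j).1) = Matrix.diagonal fun i =>
        algebraMap D (Localization.AtPrime p) (s i * (e i).2) := by
    ext i j
    have := LinearMap.congr_fun (hl i) (e j).1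
    simp only [LinearMap.comp_apply, Algebra.linearMap_apply, LinearMap.smul_apply,
      LinearMap.restrictScalars_apply] at this
    rw [RingHom.mapMatrix_apply, Matrix.map_apply, Matrix.of_apply, this, ← he j]
    rw [Submonoid.smul_def, Submonoid.smul_def, ← algebraMap_smul (Localization.AtPrime p)
      (((e j).2 : D)), map_smul, Module.Basis.coord_apply, b.repr_self, Matrix.diagonal_apply]
    by_cases hij : i = j
    · subst hij
      simp [Algebra.smul_def]
    · simp [hij]
  have h4 := RingHom.map_det (algebraMap D (Localization.AtPrime p))
    (Matrix.of fun i j => l i (e j).1)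
  rw [h3, Matrix.det_diagonal, ← map_prod] at h4
  have h5 := (IsLocalization.AtPrime.isUnit_to_map_iff (Localization.AtPrime p) p
    (∏ i, (s i * (e i).2 : D))).2 (by
      show _ ∈ p.primeCompl
      exact Submonoid.prod_mem _ fun i _ => mul_mem (s i).2 (e i).2.2)
  rw [← h4] at h5
  exact (IsLocalization.AtPrime.isUnit_to_map_iff (Localization.AtPrime p) p _).1 h5 hmem

section Lifting

variable {R : Type*} [CommRing R]

theorem exists_generators_of_monic_denominators {Q : Type*} [AddCommGroup Q] [Module R[X] Q]
    {I : Ideal R[X]} {i : R[X]} (hi : i ∈ I)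
    (hi1 : 1 - i ∈ ((⊥ : Ideal R).jacobson).map (algebraMap R R[X]))
    (hsr : ∀ (q : Q →ₗ[R[X]] R[X]) (c : R[X]),
      (∀ p : Ideal R[X], p.IsPrime → ((⊥ : Ideal R).jacobson).map (algebraMap R R[X]) ≤ p →
        (∀ f ∈ p, ¬ f.Monic) → c ∈ p → ∃ m, q m ∉ p) →
      ∃ y : Q →ₗ[R[X]] R[X], ∀ p : Ideal R[X], p.IsPrime →
        ((⊥ : Ideal R).jacobson).map (algebraMap R R[X]) ≤ p →
        (∀ f ∈ p, ¬ f.Monic) → ∃ m, q m + c * y m ∉ p)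
    (q : Q →ₗ[R[X]] R[X]) (c : R[X])
    (hden : ∀ a ∈ I, ∃ g : R[X], g.Monic ∧ ∃ x t, q x + t * c = g * a) :
    ∃ (y : Q →ₗ[R[X]] R[X]) (g c' : R[X]), g.Monic ∧
      c' - 1 ∈ ((⊥ : Ideal R).jacobson).map (algebraMap R R[X]) ∧ c' - g * c ∈ I ^ 2 ∧
      I ≤ LinearMap.range (q + (c * i ^ 2) • y) ⊔ Ideal.span {c'} := by
  set 𝔧 := ((⊥ : Ideal R).jacobson).map (algebraMap R R[X]) with h𝔧
  obtain ⟨y, hy⟩ := hsr q (c * i ^ 2) (by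
    intro p hp hJp hmon hc
    by_contra! hq
    have hip : i ∉ p := fun h => hp.ne_top ((Ideal.eq_top_iff_one _).2 (by
      simpa using p.add_mem (hJp hi1) h))
    have hcp : c ∈ p := (hp.mem_or_mem hc).resolve_right fun h => hip (hp.mem_of_pow_mem _ h)
    obtain ⟨g, hg, x, t, hx⟩ := hden i hi
    have h1 : g * i ∈ p := hx ▸ p.add_mem (hq x) (p.mul_mem_left t hcp)
    exact (hp.mem_or_mem h1).elim (fun h => hmon g h hg) hip)
  set q₁ : Q →ₗ[R[X]] R[X] := q + (c * i ^ 2) • y with hq₁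
  have hq₁a : ∀ x, q₁ x = q x + c * i ^ 2 * y x := fun x => rfl
  obtain ⟨h, hh, z, hz⟩ : ∃ h : R[X], h.Monic ∧ ∃ z, h - q₁ z ∈ 𝔧 := by
    by_contra! hcon
    have hdisj : Disjoint ((LinearMap.range q₁ ⊔ 𝔧 : Ideal R[X]) : Set R[X])
        (monicSubmonoid R : Set R[X]) := by
      rw [Set.disjoint_left]
      intro h hmem hh
      obtain ⟨_, ⟨z, rfl⟩, j, hj, hzj⟩ := Submodule.mem_sup.1 hmem
      exact hcon h hh z (by rw [← hzj]; simpa using hj)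
    obtain ⟨p, hp, hle, hpd⟩ := Ideal.exists_le_prime_disjoint _ _ hdisj
    obtain ⟨m, hm⟩ := hy p hp (le_sup_right.trans hle)
      (fun f hf hfm => Set.disjoint_left.1 hpd hf hfm)
    exact hm (hle (Ideal.mem_sup_left ⟨m, rfl⟩))
  set c₂ := h * c - i ^ 2 * c * q₁ z with hc₂
  have hc₂J : c₂ ∈ 𝔧 := by
    have h1 : c₂ = (c * h * (1 + i)) * (1 - i) + (c * i ^ 2) * (h - q₁ z) := by
      rw [hc₂]; ring
    rw [h1]
    exact 𝔧.add_mem (𝔧.mul_mem_left _ hi1) (𝔧.mul_mem_left _ hz)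
  have hden' : ∀ a ∈ I, ∃ (g t : R[X]), g.Monic ∧ ∃ x, q₁ x = h * g * a - t * c₂ := by
    intro a ha
    obtain ⟨g, hg, x, t, hx⟩ := hden a ha
    refine ⟨g, t - i ^ 2 * y x, hg, h • x + ((t - i ^ 2 * y x) * (i ^ 2 * c)) • z, ?_⟩
    rw [map_add, map_smul, map_smul, smul_eq_mul, smul_eq_mul, mul_assoc h g a, ← hx, hc₂,
      hq₁a x]
    ring
  obtain ⟨g₀, t₀, hg₀, x₀, hx₀⟩ := hden' (i ^ 2) (I.pow_mem_of_mem hi 2 (by norm_num))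
  set Y : R[X] := X ^ (t₀.natDegree + 1) with hY
  set c₃ := Y * c₂ + i ^ 2 with hc₃
  have hc₃J : c₃ - 1 ∈ 𝔧 := by
    have h1 : c₃ - 1 = Y * c₂ - (1 + i) * (1 - i) := by rw [hc₃]; ring
    rw [h1]
    exact 𝔧.sub_mem (𝔧.mul_mem_left _ hc₂J) (𝔧.mul_mem_left _ hi1)
  have hi2 : i ^ 2 ∈ I ^ 2 := Ideal.pow_mem_pow hi 2
  set K : Ideal R[X] := LinearMap.range q₁ ⊔ Ideal.span {c₃} with hK
  have hKq : ∀ x, q₁ x ∈ K := fun x => Ideal.mem_sup_left ⟨x, rfl⟩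
  have hKc : c₃ ∈ K := Ideal.mem_sup_right (Ideal.mem_span_singleton_self _)
  have hYm : Y.Monic := monic_X_pow _
  have hG : (Y * (h * g₀) + t₀).Monic := by
    rcases subsingleton_or_nontrivial R with hR | hR
    · exact monic_of_subsingleton _
    refine (hYm.mul (hh.mul hg₀)).add_of_left (degree_lt_degree ?_)
    rw [hYm.natDegree_mul (hh.mul hg₀), hY, natDegree_X_pow]
    omega
  have hGi : (Y * (h * g₀) + t₀) * i ^ 2 ∈ K := by
    have h1 : (Y * (h * g₀) + t₀) * i ^ 2 = Y * q₁ x₀ + t₀ * c₃ := by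
      rw [hx₀, hc₃]; ring
    rw [h1]
    exact K.add_mem (K.mul_mem_left _ (hKq _)) (K.mul_mem_left _ hKc)
  refine ⟨y, Y * h, c₃, hYm.mul hh, hc₃J, ?_, fun a ha => ?_⟩
  · have h1 : c₃ - Y * h * c = (1 - Y * c * q₁ z) * i ^ 2 := by rw [hc₃, hc₂]; ring
    rw [h1]
    exact Ideal.mul_mem_left _ _ hi2
  · obtain ⟨g, t, hg, x, hx⟩ := hden' a ha
    have h1 : ((Y * (h * g₀) + t₀) * (Y * h * g)) * a ∈ K := by
      have h2 : ((Y * (h * g₀) + t₀) * (Y * h * g)) * a =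
          ((Y * (h * g₀) + t₀) * Y) * q₁ x + ((Y * (h * g₀) + t₀) * t) * c₃
            - t * ((Y * (h * g₀) + t₀) * i ^ 2) := by
        rw [hx, hc₃]; ring
      rw [h2]
      exact K.sub_mem (K.add_mem (K.mul_mem_left _ (hKq _)) (K.mul_mem_left _ hKc))
        (K.mul_mem_left _ hGi)
    obtain ⟨u, v, huv⟩ := isCoprime_of_sub_one_mem_map_jacobson hc₃J
      (hG.mul ((hYm.mul hh).mul hg))
    have h3 : a = (u * a) * c₃ + v * (((Y * (h * g₀) + t₀) * (Y * h * g)) * a) := by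
      linear_combination (-a) * huv
    rw [h3]
    exact K.add_mem (K.mul_mem_left _ hKc) (K.mul_mem_left _ h1)

/-- If `ψ` agrees with `f * φ` modulo `I ^ 2` and hits `I` up to monic denominators, then `φ` can be
corrected modulo `I ^ 2` to a surjection onto `I`. -/
theorem exists_surjective_lift_of_monic_denominators {N : Type*} [AddCommGroup N] [Module R[X] N]
    {I : Ideal R[X]} {i : R[X]} (hi : i ∈ I)
    (hi1 : 1 - i ∈ ((⊥ : Ideal R).jacobson).map (algebraMap R R[X]))
    (hsr : ∀ (q : (N × R[X]) →ₗ[R[X]] R[X]) (c : R[X]),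
      (∀ p : Ideal R[X], p.IsPrime → ((⊥ : Ideal R).jacobson).map (algebraMap R R[X]) ≤ p →
        (∀ f ∈ p, ¬ f.Monic) → c ∈ p → ∃ m, q m ∉ p) →
      ∃ y : (N × R[X]) →ₗ[R[X]] R[X], ∀ p : Ideal R[X], p.IsPrime →
        ((⊥ : Ideal R).jacobson).map (algebraMap R R[X]) ≤ p →
        (∀ f ∈ p, ¬ f.Monic) → ∃ m, q m + c * y m ∉ p)
    (φ ψ : ((N × R[X]) × R[X]) →ₗ[R[X]] R[X]) (hφI : ∀ x, φ x ∈ I) {f : R[X]} (hf : f.Monic)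
    (hψ : ∀ x, ψ x - f * φ x ∈ I ^ 2)
    (hden : ∀ a ∈ I, ∃ g : R[X], g.Monic ∧ ∃ x, ψ x = g * a) :
    ∃ Φ : ((N × R[X]) × R[X]) →ₗ[R[X]] R[X],
      LinearMap.range Φ = I ∧ ∀ x, Φ x - φ x ∈ I ^ 2 := by
  have hψa : ∀ x t, ψ (x, t) = ψ (x, 0) + t * ψ (0, 1) := by
    intro x t
    rw [← smul_eq_mul, ← map_smul, ← map_add]
    simp
  obtain ⟨y, g, c, hg, hcJ, hcg, hIK⟩ := exists_generators_of_monic_denominators hi hi1 hsr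
    (ψ ∘ₗ LinearMap.inl _ _ _) (ψ (0, 1)) (by
      intro a ha
      obtain ⟨g, hg, x, hx⟩ := hden a ha
      exact ⟨g, hg, x.1, x.2, by rw [← hx]; exact (hψa x.1 x.2).symm⟩)
  set q : (N × R[X]) →ₗ[R[X]] R[X] := ψ ∘ₗ LinearMap.inl _ _ _ + (ψ (0, 1) * i ^ 2) • y with hq
  have hi2 : i ^ 2 ∈ I ^ 2 := Ideal.pow_mem_pow hi 2
  have hqφ : ∀ x, q x - f * φ (x, 0) ∈ I ^ 2 := by
    intro x
    have h1 : q x - f * φ (x, 0) = (ψ (x, 0) - f * φ (x, 0)) + (ψ (0, 1) * y x) * i ^ 2 := by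
      have h2 : q x = ψ (x, 0) + ψ (0, 1) * i ^ 2 * y x := rfl
      rw [h2]; ring
    rw [h1]
    exact Ideal.add_mem _ (hψ _) (Ideal.mul_mem_left _ _ hi2)
  set U := g * f with hU
  have hcU : c - U * φ (0, 1) ∈ I ^ 2 := by
    have h1 : c - U * φ (0, 1) = (c - g * ψ (0, 1)) + g * (ψ (0, 1) - f * φ (0, 1)) := by
      rw [hU]; ring
    rw [h1]
    exact Ideal.add_mem _ hcg (Ideal.mul_mem_left _ _ (hψ _))
  have hciJ : c * i ^ 2 - 1 ∈ ((⊥ : Ideal R).jacobson).map (algebraMap R R[X]) := by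
    have h1 : c * i ^ 2 - 1 = i ^ 2 * (c - 1) - (1 + i) * (1 - i) := by ring
    rw [h1]
    exact Ideal.sub_mem _ (Ideal.mul_mem_left _ _ hcJ) (Ideal.mul_mem_left _ _ hi1)
  obtain ⟨w, v, hwv⟩ := isCoprime_of_sub_one_mem_map_jacobson hciJ (hf.mul (hg.mul hf))
  rw [← hU] at hwv
  set κ := U * (v * f) - 1 with hκ
  have hκw : κ = -(w * c) * i ^ 2 := by rw [hκ]; linear_combination hwv
  have hκI : κ ∈ I ^ 2 := by rw [hκw]; exact Ideal.mul_mem_left _ _ hi2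
  have hdec : ∀ n s t, φ ((n, s), t) = φ ((n, 0), 0) + s * φ ((0, 1), 0) + t * φ (0, 1) := by
    intro n s t
    rw [← smul_eq_mul, ← smul_eq_mul, ← map_smul, ← map_smul, ← map_add, ← map_add]
    simp
  have hqdec : ∀ n s, q (n, s) = q (n, 0) + s * q (0, 1) := by
    intro n s
    rw [← smul_eq_mul, ← map_smul, ← map_add]
    simp
  set b := v * q (0, 1) with hb
  let Φ : ((N × R[X]) × R[X]) →ₗ[R[X]] R[X] := LinearMap.coprod (LinearMap.coprod
    ((v * U) • q ∘ₗ LinearMap.inl _ _ _) (LinearMap.toSpanSingleton R[X] R[X] (U * b - κ * c)))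
    (LinearMap.toSpanSingleton R[X] R[X] (κ * b + v * f * (1 - κ) * c))
  have hΦ : ∀ n s t, Φ ((n, s), t) = v * U * q (n, 0) + s * (U * b - κ * c)
      + t * (κ * b + v * f * (1 - κ) * c) := fun n s t => rfl
  have hΦφ : ∀ x, Φ x - φ x ∈ I ^ 2 := by
    rintro ⟨⟨n, s⟩, t⟩
    rw [hΦ, hdec]
    have h1 : v * U * q (n, 0) + s * (U * b - κ * c) + t * (κ * b + v * f * (1 - κ) * c) -
        (φ ((n, 0), 0) + s * φ ((0, 1), 0) + t * φ (0, 1)) =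
        v * U * (q (n, 0) - f * φ ((n, 0), 0)) + s * (U * v) * (q (0, 1) - f * φ ((0, 1), 0))
          + t * (v * f) * (c - U * φ (0, 1))
          + κ * (φ ((n, 0), 0) + s * φ ((0, 1), 0) - s * c
            + t * (b - v * f * c + φ (0, 1))) := by
      rw [hb, hκ]; ring
    rw [h1]
    exact Ideal.add_mem _ (Ideal.add_mem _ (Ideal.add_mem _ (Ideal.mul_mem_left _ _ (hqφ _))
      (Ideal.mul_mem_left _ _ (hqφ _))) (Ideal.mul_mem_left _ _ hcU))
      (Ideal.mul_mem_right _ _ hκI)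
  refine ⟨Φ, le_antisymm ?_ (hIK.trans ?_), hΦφ⟩
  · rintro _ ⟨x, rfl⟩
    have h1 := I.add_mem (Ideal.pow_le_self two_ne_zero (hΦφ x)) (hφI x)
    simpa using h1
  · have hc : c ∈ LinearMap.range Φ := ⟨((0, -κ), U), by
      rw [hΦ, show ((0 : N), (0 : R[X])) = 0 from rfl, map_zero, hκ]; ring⟩
    have hb' : b ∈ LinearMap.range Φ := ⟨((0, v * f * (1 - κ)), κ), by
      rw [hΦ, show ((0 : N), (0 : R[X])) = 0 from rfl, map_zero, hκ]; ring⟩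
    refine sup_le ?_ ((Ideal.span_singleton_le_iff_mem _).2 hc)
    rintro _ ⟨⟨n, s⟩, rfl⟩
    have hα : v * U * q (n, 0) ∈ LinearMap.range Φ := ⟨((n, 0), 0), by rw [hΦ]; ring⟩
    have h1 : q (n, s) = f • (v * U * q (n, 0)) + (s * f * U) • b
        + (w * i ^ 2 * (q (n, 0) + s * q (0, 1))) • c := by
      rw [hqdec, hb]
      simp only [smul_eq_mul]
      linear_combination (-(q (n, 0) + s * q (0, 1))) * hwv
    rw [h1]
    exact Submodule.add_mem _ (Submodule.add_mem _ (Submodule.smul_mem _ _ hα)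
      (Submodule.smul_mem _ _ hb')) (Submodule.smul_mem _ _ hc)

end Lifting

section Dimension

theorem Ideal.exists_forall_exists_add_mul_notMem_of_height_lt {D M : Type*} [CommRing D]
    [IsNoetherianRing D] [AddCommGroup M] [Module D M] [Module.Finite D M] [Module.Projective D M]
    {r : ℕ} (hr : ∀ p, Module.rankAtStalk (R := D) M p = r) {s : ℕ} (hs : s ≤ r) (𝔞 : Ideal D)
    (m : ℕ) (hm : ∀ p : Ideal D, p.IsPrime → 𝔞 ≤ p → m ≤ p.height)
    (X : Set (Ideal D)) (hX : ∀ p ∈ X, p.IsPrime ∧ 𝔞 ≤ p ∧ p.height < (m + s : ℕ))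
    (q : M →ₗ[D] D) (c : D) (hq : ∀ p ∈ X, c ∈ p → ∃ x, q x ∉ p) :
    ∃ y : M →ₗ[D] D, ∀ p ∈ X, ∃ x, q x + c * y x ∉ p := by
  have hfin : ∀ p : Ideal D, p.IsPrime → ((p.height.toNat : ℕ) : ℕ∞) = p.height := fun p hp =>
    ENat.natCast_toNat (Ideal.height_ne_top hp.ne_top)
  have hm' : ∀ p : Ideal D, p.IsPrime → 𝔞 ≤ p → m ≤ p.height.toNat := by
    intro p hp hap
    have h := hm p hp hap
    rw [← hfin p hp] at h
    exact_mod_cast h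
  refine exists_forall_exists_add_mul_notMem
    (fun p hp => Module.exists_det_notMem_of_rankAtStalk p (hr ⟨p, hp⟩)) s hs 𝔞
    (fun p => p.height.toNat - m) (fun p p' hp hp' hap hlt => ?_) X (fun p hp => ?_) q c hq
  · have h1 := Ideal.height_add_one_le_of_lt_of_isPrime hlt
    rw [← hfin p hp, ← hfin p' hp'] at h1
    have h2 : p.height.toNat + 1 ≤ p'.height.toNat := by exact_mod_cast h1
    have h3 := hm' p hp hap
    show p.height.toNat - m < p'.height.toNat - m
    omega
  · obtain ⟨h1, h2, h3⟩ := hX p hp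
    rw [← hfin p h1] at h3
    have h4 : p.height.toNat < m + s := by exact_mod_cast h3
    have h5 := hm' p h1 h2
    exact ⟨h1, h2, by show p.height.toNat - m < s; omega⟩

theorem Module.nonempty_equiv_ker_prod_of_range_eq_top {R P : Type*} [CommRing R] [AddCommGroup P]
    [Module R P] (y : P →ₗ[R] R) (hy : LinearMap.range y = ⊤) :
    Nonempty (P ≃ₗ[R] LinearMap.ker y × R) := by
  obtain ⟨x, hx⟩ := LinearMap.range_eq_top.1 hy 1
  have hl : y ∘ₗ LinearMap.toSpanSingleton R P x = LinearMap.id := by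
    ext
    simp [hx]
  exact ⟨(Function.Exact.splitSurjectiveEquiv (LinearMap.exact_subtype_ker_map y)
    (LinearMap.ker y).injective_subtype ⟨_, hl⟩).1⟩

/-- A projective module of rank larger than the dimension of `R` at primes above the Jacobson
radical, counted from height `m`, splits off a free summand of rank one. -/
theorem Module.exists_submodule_equiv_prod {R P : Type*} [CommRing R] [IsNoetherianRing R]
    [AddCommGroup P] [Module R P] [Module.Finite R P] [Module.Projective R P] {d : ℕ}
    (hdim : ringKrullDim R = d) {r : ℕ} (hr : ∀ p, Module.rankAtStalk (R := R) P p = r + 1) (m : ℕ)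
    (hm : ∀ p : Ideal R, p.IsPrime → (⊥ : Ideal R).jacobson ≤ p → m ≤ p.height)
    (hd : d < m + (r + 1)) :
    ∃ N : Submodule R P, Nonempty (P ≃ₗ[R] N × R) ∧ Module.Projective R N ∧
      ∀ p, Module.rankAtStalk (R := R) N p = r := by
  obtain ⟨y, hy⟩ := Ideal.exists_forall_exists_add_mul_notMem_of_height_lt hr le_rfl
    ((⊥ : Ideal R).jacobson) m hm {p | p.IsPrime ∧ (⊥ : Ideal R).jacobson ≤ p}
    (fun p hp => ⟨hp.1, hp.2, by
      have h1 := Ideal.height_le_ringKrullDim_of_ne_top hp.1.ne_top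
      rw [hdim] at h1
      have h2 : p.height ≤ d := by exact_mod_cast h1
      exact lt_of_le_of_lt h2 (by exact_mod_cast hd)⟩)
    (0 : P →ₗ[R] R) 1 (fun p hp h => absurd ((Ideal.eq_top_iff_one _).2 h) hp.1.ne_top)
  have hytop : LinearMap.range y = ⊤ := by
    by_contra hne
    obtain ⟨𝔪, h𝔪, hle⟩ := Ideal.exists_le_maximal _ hne
    obtain ⟨x, hx⟩ := hy 𝔪 ⟨h𝔪.isPrime, sInf_le ⟨bot_le, h𝔪⟩⟩
    refine hx ?_
    have : y x ∈ 𝔪 := hle ⟨x, rfl⟩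
    simpa using this
  obtain ⟨e⟩ := Module.nonempty_equiv_ker_prod_of_range_eq_top y hytop
  have hproj : Module.Projective R (LinearMap.ker y) :=
    Module.Projective.of_split (e.symm.toLinearMap ∘ₗ LinearMap.inl _ _ _)
      (LinearMap.fst _ _ _ ∘ₗ e.toLinearMap) (by ext; simp)
  refine ⟨LinearMap.ker y, ⟨e⟩, hproj, fun p => ?_⟩
  have : Nontrivial R := p.nontrivial
  have h1 := hr p
  rw [Module.rankAtStalk_eq_of_equiv e, Module.rankAtStalk_prod, Module.rankAtStalk_self] at h1
  simpa using h1

end Dimension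

/-- Clearing monic denominators in a surjection over the localization. -/
theorem exists_lift_of_localized_surjection {R : Type*} [CommRing R] {I : Ideal R[X]} {i : R[X]}
    (hi : i ∈ I) (hi1 : 1 - i ∈ ((⊥ : Ideal R).jacobson).map (algebraMap R R[X]))
    {M : Type*} [AddCommGroup M] [Module R[X] M] [Module.FinitePresentation R[X] M]
    (φ : M →ₗ[R[X]] R[X])
    (Ψ : (LocalizedModule (monicSubmonoid R) M)
        →ₗ[Localization (monicSubmonoid R)] Localization (monicSubmonoid R))
    (hrange : LinearMap.range Ψ =
        (I.map (algebraMap (Polynomial R) (Localization (monicSubmonoid R))) :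
          Ideal (Localization (monicSubmonoid R))))
    (hΨ : ∀ x, Ψ (LocalizedModule.mkLinearMap (monicSubmonoid R) M x) -
          algebraMap (Polynomial R) (Localization (monicSubmonoid R)) (φ x) ∈
        (I ^ 2).map (algebraMap (Polynomial R) (Localization (monicSubmonoid R)))) :
    ∃ (ψ : M →ₗ[R[X]] R[X]) (f : R[X]), f.Monic ∧ (∀ x, ψ x - f * φ x ∈ I ^ 2) ∧
      ∀ a ∈ I, ∃ g : R[X], g.Monic ∧ ∃ x, ψ x = g * a := by
  obtain ⟨ψ, s, hψ⟩ := Module.FinitePresentation.exists_lift_of_isLocalizedModule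
    (monicSubmonoid R) (Algebra.linearMap R[X] (Localization (monicSubmonoid R)))
    (Ψ.restrictScalars R[X] ∘ₗ LocalizedModule.mkLinearMap (monicSubmonoid R) M)
  have hψ' : ∀ x, algebraMap R[X] (Localization (monicSubmonoid R)) (ψ x) =
      algebraMap R[X] (Localization (monicSubmonoid R)) s *
        Ψ (LocalizedModule.mkLinearMap (monicSubmonoid R) M x) := by
    intro x
    have := LinearMap.congr_fun hψ x
    rw [← Algebra.smul_def]
    exact this
  refine ⟨ψ, s, s.2, fun x => ?_, fun a ha => ?_⟩
  · have h1 : algebraMap R[X] (Localization (monicSubmonoid R)) (ψ x - s * φ x) ∈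
        (I ^ 2).map (algebraMap (Polynomial R) (Localization (monicSubmonoid R))) := by
      rw [map_sub, map_mul, hψ', ← mul_sub]
      exact Ideal.mul_mem_left _ _ (hΨ x)
    obtain ⟨g, hg, hgm⟩ :=
      (IsLocalization.algebraMap_mem_map_algebraMap_iff (monicSubmonoid R) _ _ _).1 h1
    have hiJ : i ^ 2 - 1 ∈ ((⊥ : Ideal R).jacobson).map (algebraMap R R[X]) := by
      have h2 : i ^ 2 - 1 = -(1 + i) * (1 - i) := by ring
      rw [h2]
      exact Ideal.mul_mem_left _ _ hi1
    obtain ⟨u, v, huv⟩ := isCoprime_of_sub_one_mem_map_jacobson hiJ hg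
    have h3 : ψ x - s * φ x = (u * (ψ x - s * φ x)) * i ^ 2 + v * (g * (ψ x - s * φ x)) := by
      linear_combination (-(ψ x - s * φ x)) * huv
    rw [h3]
    exact Ideal.add_mem _ (Ideal.mul_mem_left _ _ (Ideal.pow_mem_pow hi 2))
      (Ideal.mul_mem_left _ _ hgm)
  · obtain ⟨ξ, hξ⟩ : algebraMap R[X] (Localization (monicSubmonoid R)) a ∈ LinearMap.range Ψ := by
      rw [hrange]
      exact Ideal.mem_map_of_mem _ ha
    obtain ⟨⟨x, t⟩, hx⟩ := IsLocalizedModule.surj (monicSubmonoid R)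
      (LocalizedModule.mkLinearMap (monicSubmonoid R) M) ξ
    have h1 : algebraMap R[X] (Localization (monicSubmonoid R)) (ψ x) =
        algebraMap R[X] (Localization (monicSubmonoid R)) (s * t * a) := by
      rw [hψ', ← hx, Submonoid.smul_def, ← algebraMap_smul (Localization (monicSubmonoid R)),
        map_smul, hξ, smul_eq_mul, map_mul, map_mul, mul_assoc]
    obtain ⟨g, hg⟩ := (IsLocalization.eq_iff_exists (monicSubmonoid R) _).1 h1
    refine ⟨g * (s * t), g.2.mul (s.2.mul t.2), (g : R[X]) • x, ?_⟩
    rw [map_smul, smul_eq_mul, hg]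
    ring

/-- (Lemma 7.2) Let `R` be Noetherian of dimension `d`, `2n ≥ d + 3`, `I ⊆ R[T]` an ideal of
height `n` with `I + 𝒥(R)R[T] = R[T]` and `ht 𝒥(R) ≥ d − n + 2`, `P` a finitely generated
projective `R`-module of rank `n`, and `φ : P[T] → I` inducing a surjection onto `I/I²`.  If
`φ ⊗ R(T)` lifts to a surjection `P(T) ↠ I R(T)`, then `φ` lifts to a surjection
`Φ : P[T] ↠ I`. -/
theorem stmt14 (R : Type*) [CommRing R] [IsNoetherianRing R]
    (d n : ℕ) (hdim : ringKrullDim R = d) (hn : d + 3 ≤ 2 * n)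
    (hhtJ : ∀ m : ℕ, (m : ℤ) = (d : ℤ) - n + 2 →
      (m : WithBot (WithTop ℕ)) ≤ idealHt ((⊥ : Ideal R).jacobson))
    (I : Ideal (Polynomial R)) (hI : idealHt I = n)
    (hcomax : I ⊔ Ideal.map (algebraMap R (Polynomial R)) ((⊥ : Ideal R).jacobson) = ⊤)
    (P : Type*) [AddCommGroup P] [Module R P] [Module.Finite R P] [Module.Projective R P]
    (hrank : HasRank R P n)
    (φ : (Polynomial R ⊗[R] P) →ₗ[Polynomial R] Polynomial R)
    (hφI : LinearMap.range φ ≤ I)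
    (hφsurj : LinearMap.range φ ⊔ ((I ^ 2 : Ideal (Polynomial R)) :
      Submodule (Polynomial R) (Polynomial R)) = I)
    (hloc : ∃ Ψ : (LocalizedModule (monicSubmonoid R) (Polynomial R ⊗[R] P))
        →ₗ[Localization (monicSubmonoid R)] Localization (monicSubmonoid R),
      LinearMap.range Ψ =
        (I.map (algebraMap (Polynomial R) (Localization (monicSubmonoid R))) :
          Ideal (Localization (monicSubmonoid R))) ∧
      ∀ x, Ψ (LocalizedModule.mkLinearMap (monicSubmonoid R) (Polynomial R ⊗[R] P) x) -
          algebraMap (Polynomial R) (Localization (monicSubmonoid R)) (φ x) ∈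
        (I ^ 2).map (algebraMap (Polynomial R) (Localization (monicSubmonoid R)))) :
    ∃ Φ : (Polynomial R ⊗[R] P) →ₗ[Polynomial R] Polynomial R,
      LinearMap.range Φ = I ∧ ∀ x, Φ x - φ x ∈ (I ^ 2 : Ideal (Polynomial R)) := by
  obtain ⟨Ψ, hΨ, hΨφ⟩ := hloc
  obtain ⟨i, hi, j, hj, hij⟩ := Submodule.mem_sup.1
    ((Ideal.eq_top_iff_one _).1 hcomax)
  have hi1 : 1 - i ∈ ((⊥ : Ideal R).jacobson).map (algebraMap R R[X]) := by
    rw [← hij, add_sub_cancel_left]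
    exact hj
  have hfp : Module.FinitePresentation R[X] (R[X] ⊗[R] P) :=
    Module.finitePresentation_of_projective _ _
  obtain ⟨ψ, f, hf, hψ, hden⟩ := exists_lift_of_localized_surjection hi hi1 φ Ψ hΨ hΨφ
  obtain ⟨m, hmd, hm⟩ : ∃ m : ℕ, d + 2 ≤ m + n ∧
      ∀ p : Ideal R, p.IsPrime → (⊥ : Ideal R).jacobson ≤ p → m ≤ p.height := by
    refine ⟨d + 2 - n, by omega, fun p hp hJp => ?_⟩
    rcases le_total n (d + 2) with h | h
    · have h1 := hhtJ (d + 2 - n) (by omega)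
      have h2 : idealHt ((⊥ : Ideal R).jacobson) ≤ ringKrullDim (Localization.AtPrime p) :=
        iInf₂_le (⟨p, hp⟩ : PrimeSpectrum R) hJp
      rw [IsLocalization.AtPrime.ringKrullDim_eq_height p] at h2
      exact WithBot.coe_le_coe.1 (h1.trans h2)
    · rw [Nat.sub_eq_zero_of_le h]
      simp
  have hr : ∀ p, Module.rankAtStalk (R := R) P p = n := fun p =>
    Module.finrank_eq_of_rank_eq (hrank p)
  obtain ⟨k, rfl⟩ : ∃ k, n = k + 2 := ⟨n - 2, by omega⟩
  obtain ⟨N₁, ⟨e₁⟩, hN₁, hr₁⟩ :=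
    Module.exists_submodule_equiv_prod (r := k + 1) hdim hr m hm (by omega)
  obtain ⟨N₂, ⟨e₂⟩, hN₂, hr₂⟩ :=
    Module.exists_submodule_equiv_prod (r := k) hdim hr₁ m hm (by omega)
  let e : (R[X] ⊗[R] P) ≃ₗ[R[X]] ((R[X] ⊗[R] N₂) × R[X]) × R[X] :=
    (e₁.trans (e₂.prodCongr (LinearEquiv.refl R R))).baseChange R R[X] _ _ ≪≫ₗ
      TensorProduct.prodRight R R[X] R[X] (N₂ × R) R ≪≫ₗ
      (TensorProduct.prodRight R R[X] R[X] N₂ R ≪≫ₗ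
        (LinearEquiv.refl _ _).prodCongr
          (TensorProduct.AlgebraTensorModule.rid R R[X] R[X])).prodCongr
      (TensorProduct.AlgebraTensorModule.rid R R[X] R[X])
  have hrQ : ∀ p, Module.rankAtStalk (R := R[X]) ((R[X] ⊗[R] N₂) × R[X]) p = k + 1 := by
    intro p
    have : Nontrivial R[X] := p.nontrivial
    rw [Module.rankAtStalk_prod, Module.rankAtStalk_self, Pi.add_apply,
      Module.rankAtStalk_baseChange, hr₂]
    rfl
  have hmA : ∀ p : Ideal R[X], p.IsPrime →
      ((⊥ : Ideal R).jacobson).map (algebraMap R R[X]) ≤ p → m ≤ p.height := by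
    intro p hp hJp
    refine (hm (p.under R) inferInstance (Ideal.map_le_iff_le_comap.1 hJp)).trans ?_
    rw [Ideal.height_eq_height_add_of_liesOver_of_hasGoingDown (p.under R) p]
    exact le_self_add
  obtain ⟨Φ, hΦ, hΦφ⟩ := exists_surjective_lift_of_monic_denominators hi hi1
    (fun q c hqc => by
      obtain ⟨y, hy⟩ := Ideal.exists_forall_exists_add_mul_notMem_of_height_lt hrQ le_rfl _ m hmA
        {p | p.IsPrime ∧ ((⊥ : Ideal R).jacobson).map (algebraMap R R[X]) ≤ p ∧
          ∀ f ∈ p, ¬ f.Monic}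
        (fun p hp => ⟨hp.1, hp.2.1, by
          have := hp.1
          exact lt_of_le_of_lt (Polynomial.height_le_of_forall_notMem_monic hdim p hp.2.2)
            (by exact_mod_cast (by omega))⟩)
        q c (fun p hp => hqc p hp.1 hp.2.1 hp.2.2)
      exact ⟨y, fun p h1 h2 h3 => hy p ⟨h1, h2, h3⟩⟩)
    (φ ∘ₗ e.symm.toLinearMap) (ψ ∘ₗ e.symm.toLinearMap) (fun x => hφI ⟨e.symm x, rfl⟩) hf
    (fun x => hψ (e.symm x)) (fun a ha => by
      obtain ⟨g, hg, x, hx⟩ := hden a ha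
      exact ⟨g, hg, e x, by simpa using hx⟩)
  refine ⟨Φ ∘ₗ e.toLinearMap, ?_, fun x => ?_⟩
  · rw [LinearMap.range_comp, LinearEquiv.range, Submodule.map_top, hΦ]
  · simpa using hΦφ (e x)
end
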